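/- Let r ≥ 3 and q ≥ 2. For every ε > 0, there exist ζ > 0 and n₀ such that for every n ≥ n₀ with r | n the following holds. Let (G,f) be a q-edge-colored n-vertex graph with minimum degree δ(G) ≥ ((r−1)/r + ε)·n, and set ρ = 2δ(G)/n − 1. Then there exists a K_r-tiling T of G and a color c ∈ {1,…,q} which appears on at least a min(1/q + ζ, (ρ − ε)/C(r,2))-fraction of the edges of T. -/

import Mathlib

open Finset

variable {V : Type*}

/-- A `Kᵣ`-tiling of the vertex set `W`: a collection of pairwise-disjoint `r`-cliques of `G`
whose union is `W`. -/
def IsKrTilingOn [DecidableEq V] (G : SimpleGraph V) (r : ℕ)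
    (T : Finset (Finset V)) (W : Finset V) : Prop :=
  (∀ K ∈ T, G.IsNClique r K) ∧
  (∀ K ∈ T, ∀ K' ∈ T, K ≠ K' → Disjoint K K') ∧
  T.biUnion id = W

/-- A perfect `Kᵣ`-tiling of `G`. -/
def IsKrTiling [Fintype V] [DecidableEq V] (G : SimpleGraph V) (r : ℕ)
    (T : Finset (Finset V)) : Prop :=
  IsKrTilingOn G r T Finset.univ

/-- The number of edges of color `c` lying inside the cliques of `T`. -/
def tilingColorCount [DecidableEq V] {q : ℕ} (f : Sym2 V → Fin q)
    (T : Finset (Finset V)) (c : Fin q) : ℕ :=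
  ∑ K ∈ T, (K.sym2.filter fun e => ¬ e.IsDiag ∧ f e = c).card

/-- The total number of edges lying inside the cliques of `T`. -/
def tilingEdgeCount [DecidableEq V] (T : Finset (Finset V)) : ℕ :=
  ∑ K ∈ T, (K.sym2.filter fun e => ¬ e.IsDiag).card


section HS
open Classical

/-- `f` is a proper colouring of `X` with colours in `K`. -/
def HSProper (G : SimpleGraph V) (X : Finset V) (K : Finset ℕ) (f : V → ℕ) : Prop :=
  (∀ x ∈ X, f x ∈ K) ∧ ∀ x ∈ X, ∀ y ∈ X, G.Adj x y → f x ≠ f y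

/-- size of a colour class -/
noncomputable def HScls (X : Finset V) (f : V → ℕ) (c : ℕ) : Finset V := X.filter (fun x => f x = c)

/-- a vertex is free towards a class -/
def HSfree (G : SimpleGraph V) (X : Finset V) (f : V → ℕ) (x : V) (d : ℕ) : Prop :=
  ∀ y ∈ X, f y = d → ¬ G.Adj x y

/-- movability inside `L` -/
def HSmv (G : SimpleGraph V) (X : Finset V) (f : V → ℕ) (L : Finset ℕ) (c d : ℕ) : Prop :=
  c ∈ L ∧ d ∈ L ∧ ∃ x ∈ X, f x = c ∧ HSfree G X f x d

lemma HS_path_avoid {R : ℕ → ℕ → Prop} {c m : ℕ} (hcm : c ≠ m) :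
    ∀ a, Relation.ReflTransGen R a m →
      (a ≠ c ∧ Relation.ReflTransGen (fun x y => x ≠ c ∧ y ≠ c ∧ R x y) a m) ∨
      ∃ c1, c1 ≠ c ∧ R c c1 ∧ Relation.ReflTransGen (fun x y => x ≠ c ∧ y ≠ c ∧ R x y) c1 m := by
  intro a h
  induction h using Relation.ReflTransGen.head_induction_on with
  | refl => exact Or.inl ⟨hcm.symm, Relation.ReflTransGen.refl⟩
  | head hab hbm ih =>
    rename_i a b
    rcases ih with ⟨hb, hr⟩ | h
    · by_cases hac : a = c
      · subst hac
        exact Or.inr ⟨b, hb, hab, hr⟩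
      · exact Or.inl ⟨hac, Relation.ReflTransGen.head ⟨hac, hb, hab⟩ hr⟩
    · exact Or.inr h

lemma HS_path_avoid' {G : SimpleGraph V} {X : Finset V} {f : V → ℕ} {L : Finset ℕ} {c m : ℕ}
    (hcm : c ≠ m) (h : Relation.ReflTransGen (HSmv G X f L) c m) :
    ∃ c1, c1 ≠ c ∧ HSmv G X f L c c1 ∧ Relation.ReflTransGen (HSmv G X f (L.erase c)) c1 m := by
  rcases HS_path_avoid hcm c h with ⟨h1, -⟩ | ⟨c1, h1, h2, h3⟩
  · exact absurd rfl h1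
  · refine ⟨c1, h1, h2, Relation.ReflTransGen.mono (fun x y => ?_) c1 m h3⟩
    rintro ⟨hx, hy, h4, h5, h6⟩
    exact ⟨mem_erase.2 ⟨hx, h4⟩, mem_erase.2 ⟨hy, h5⟩, h6⟩

lemma HS_shift (G : SimpleGraph V) (X : Finset V) (K : Finset ℕ) (f : V → ℕ)
    (hf : HSProper G X K f) (m : ℕ) : ∀ (N : ℕ) (L : Finset ℕ), L.card = N → L ⊆ K → ∀ c,
      Relation.ReflTransGen (HSmv G X f L) c m →
      ∃ f' : V → ℕ, HSProper G X K f' ∧ (∀ x, f x ∉ L → f' x = f x) ∧ (∀ x, f x ∈ L → f' x ∈ L) ∧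
        (∀ x, f' x = c → f x = c) ∧
        ∀ d, (HScls X f' d).card + (if d = c then 1 else 0)
          = (HScls X f d).card + (if d = m then 1 else 0) := by
  intro N
  induction N with
  | zero =>
    intro L hL _ c h
    have hL' : L = ∅ := card_eq_zero.1 hL
    subst hL'
    rcases Relation.ReflTransGen.cases_head h with h | ⟨d, h, -⟩
    · subst h
      exact ⟨f, hf, fun _ _ => rfl, fun _ h => h, fun _ h => h, fun _ => rfl⟩
    · exact absurd h.1 (by simp)
  | succ N ih =>
    intro L hL hLK c h
    by_cases hcm : c = m
    · subst hcm
      exact ⟨f, hf, fun _ _ => rfl, fun _ h => h, fun _ h => h, fun _ => rfl⟩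
    obtain ⟨c1, hc1, ⟨hcL, hc1L, x0, hx0, hfx0, hfree⟩, hr⟩ := HS_path_avoid' hcm h
    obtain ⟨f', hf', h1, h2, h3, h4⟩ := ih (L.erase c) (by rw [card_erase_of_mem hcL]; omega)
      ((erase_subset _ _).trans hLK) c1 hr
    have hx0' : f' x0 = c := by rw [h1 x0 (by simp [hfx0]), hfx0]
    have hcc : ∀ x, f' x = c ↔ f x = c := by
      intro x
      constructor
      · intro hx
        by_contra hne
        by_cases hxL : f x ∈ L
        · have := h2 x (mem_erase.2 ⟨hne, hxL⟩)
          rw [hx] at this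
          simp at this
        · rw [h1 x (fun h => hxL (mem_of_mem_erase h))] at hx
          exact hne hx
      · intro hx
        rw [h1 x (by simp [hx]), hx]
    refine ⟨Function.update f' x0 c1, ⟨?_, ?_⟩, ?_, ?_, ?_, ?_⟩
    · intro x hx
      by_cases hxx : x = x0
      · subst hxx; simpa using hLK hc1L
      · simpa [hxx] using hf'.1 x hx
    · intro x hx y hy hxy
      by_cases hxx : x = x0
      · subst hxx
        have hyx : y ≠ x := hxy.ne'
        simp only [Function.update_self, Function.update_of_ne hyx]
        intro he
        exact hfree y hy (h3 y he.symm) hxy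
      · by_cases hyx : y = x0
        · subst hyx
          simp only [Function.update_self, Function.update_of_ne hxx]
          intro he
          exact hfree x hx (h3 x he) hxy.symm
        · simp only [Function.update_of_ne hxx, Function.update_of_ne hyx]
          exact hf'.2 x hx y hy hxy
    · intro x hx
      have hxx : x ≠ x0 := by rintro rfl; exact hx (hfx0 ▸ hcL)
      rw [Function.update_of_ne hxx]
      exact h1 x (fun h => hx (mem_of_mem_erase h))
    · intro x hx
      by_cases hxx : x = x0
      · subst hxx; simpa using hc1L
      · rw [Function.update_of_ne hxx]
        by_cases hxc : f x = c
        · rw [(hcc x).2 hxc]; exact hcL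
        · exact mem_of_mem_erase (h2 x (mem_erase.2 ⟨hxc, hx⟩))
    · intro x hx
      by_cases hxx : x = x0
      · subst hxx; simp at hx; exact absurd hx hc1
      · rw [Function.update_of_ne hxx] at hx
        exact (hcc x).1 hx
    · intro d
      have h5 := h4 d
      by_cases hdc : d = c
      · subst hdc
        have : HScls X (Function.update f' x0 c1) d = (HScls X f' d).erase x0 := by
          ext x
          by_cases hxx : x = x0
          · subst hxx; simp [HScls, hc1]
          · simp [HScls, hxx]
        rw [this, card_erase_of_mem (by simp [HScls, hx0, hx0'])]
        have hpos : 0 < (HScls X f' d).card := card_pos.2 ⟨x0, by simp [HScls, hx0, hx0']⟩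
        simp only [hc1.symm, if_false] at h5
        simp only [if_true]
        omega
      · by_cases hd1 : d = c1
        · subst hd1
          have : HScls X (Function.update f' x0 d) d = insert x0 (HScls X f' d) := by
            ext x
            by_cases hxx : x = x0
            · subst hxx; simp [HScls, hx0]
            · simp [HScls, hxx]
          rw [this, card_insert_of_notMem (by simp [HScls, hx0', hc1.symm])]
          simp only [if_true] at h5
          simp only [hdc, if_false]
          omega
        · have : HScls X (Function.update f' x0 c1) d = HScls X f' d := by
            ext x
            by_cases hxx : x = x0
            · subst hxx
              simp [HScls, hx0', Ne.symm hd1, Ne.symm hdc]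
            · simp [HScls, hxx]
          rw [this]
          simp only [hd1, if_false] at h5
          simp only [hdc, if_false]
          omega
end HS

section HS2
open Classical

/-- hypotheses of the nearly equitable situation -/
structure HSctx (G : SimpleGraph V) (X : Finset V) (K A : Finset ℕ) (f : V → ℕ) (m p s : ℕ) : Prop where
  proper : HSProper G X K f
  AK : A ⊆ K
  mA : m ∈ A
  pK : p ∈ K
  pA : p ∉ A
  size : ∀ d ∈ K, (HScls X f d).card + (if d = m then 1 else 0) = s + (if d = p then 1 else 0)
  reach : ∀ c ∈ A, Relation.ReflTransGen (HSmv G X f A) c m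
  sep : ∀ y ∈ X, f y ∉ A → ∀ d ∈ A, ¬ HSfree G X f y d
  deg : ∀ v ∈ X, (X.filter (G.Adj v)).card < K.card

lemma HS_deg (G : SimpleGraph V) (X : Finset V) (A D : Finset ℕ) (f : V → ℕ) (hD : D ⊆ A) (v : V) :
    ((X.filter (fun x => f x ∉ A)).filter (G.Adj v)).card
      + ∑ d ∈ D, (X.filter (fun x => G.Adj v x ∧ f x = d)).card ≤ (X.filter (G.Adj v)).card := by
  have h1 : ∑ d ∈ D, (X.filter (fun x => G.Adj v x ∧ f x = d)).card
      = (X.filter (fun x => G.Adj v x ∧ f x ∈ D)).card := by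
    rw [card_eq_sum_card_fiberwise (f := f) (t := D)]
    · apply sum_congr rfl
      intro d hd
      congr 1
      ext x
      simp only [mem_filter]
      constructor
      · rintro ⟨h1, h2, h3⟩; exact ⟨⟨h1, h2, h3 ▸ hd⟩, h3⟩
      · rintro ⟨⟨h1, h2, h3⟩, h4⟩; exact ⟨h1, h2, h4⟩
    · intro x hx
      simp at hx ⊢
      exact hx.2.2
  rw [h1, ← card_union_of_disjoint]
  · apply card_le_card
    intro x hx
    simp only [mem_union, mem_filter] at hx ⊢
    tauto
  · rw [disjoint_left]
    intro x hx hx'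
    simp only [mem_filter] at hx hx'
    exact hx.1.2 (hD hx'.2.2)

lemma HS_notfree {G : SimpleGraph V} {X : Finset V} {f : V → ℕ} {v : V} {d : ℕ}
    (h : ¬ HSfree G X f v d) : 1 ≤ (X.filter (fun x => G.Adj v x ∧ f x = d)).card := by
  unfold HSfree at h
  push Not at h
  obtain ⟨y, h1, h2, h3⟩ := h
  exact card_pos.2 ⟨y, by simp [h1, h2, h3]⟩

lemma HSctx.cardB {G : SimpleGraph V} {X : Finset V} {K A : Finset ℕ} {f : V → ℕ} {m p s : ℕ}
    (h : HSctx G X K A f m p s) :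
    (X.filter (fun x => f x ∉ A)).card = (K \ A).card * s + 1 := by
  rw [card_eq_sum_card_fiberwise (f := f) (t := K \ A)]
  · have : ∀ d ∈ K \ A, ((X.filter (fun x => f x ∉ A)).filter (fun x => f x = d)).card
        = s + if d = p then 1 else 0 := by
      intro d hd
      have hd' := mem_sdiff.1 hd
      have h1 := h.size d hd'.1
      have hdm : d ≠ m := by rintro rfl; exact hd'.2 h.mA
      simp only [hdm, if_false, add_zero] at h1
      rw [← h1]
      congr 1
      ext x
      simp only [HScls, mem_filter]
      constructor
      · rintro ⟨⟨h1, h2⟩, h3⟩; exact ⟨h1, h3⟩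
      · rintro ⟨h1, h3⟩; exact ⟨⟨h1, h3 ▸ hd'.2⟩, h3⟩
    rw [sum_congr rfl this, sum_add_distrib, sum_const, smul_eq_mul, sum_ite_eq', if_pos]
    exact mem_sdiff.2 ⟨h.pK, h.pA⟩
  · intro x hx
    simp at hx ⊢
    exact ⟨h.proper.1 x hx.1, hx.2⟩

lemma HSctx.degB {G : SimpleGraph V} {X : Finset V} {K A : Finset ℕ} {f : V → ℕ} {m p s : ℕ}
    (h : HSctx G X K A f m p s) (y : V) (hy : y ∈ X) (hyA : f y ∉ A) :
    ((X.filter (fun x => f x ∉ A)).filter (G.Adj y)).card < (K \ A).card := by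
  have h1 := HS_deg G X A A f (Subset.refl _) y
  have h2 : ∑ d ∈ A, 1 ≤ ∑ d ∈ A, (X.filter (fun x => G.Adj y x ∧ f x = d)).card :=
    sum_le_sum (fun d hd => HS_notfree (h.sep y hy hyA d hd))
  have h3 := h.deg y hy
  have h4 := card_sdiff_add_card_eq_card h.AK
  simp at h2
  omega

lemma HSctx.two {G : SimpleGraph V} {X : Finset V} {K A : Finset ℕ} {f : V → ℕ} {m p s : ℕ}
    (h : HSctx G X K A f m p s) : (A.erase m).Nonempty := by
  by_contra hne
  rw [not_nonempty_iff_eq_empty] at hne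
  have hA : A.card = 1 := by
    have h5 := card_erase_of_mem h.mA
    rw [hne, card_empty] at h5
    have h6 := card_pos.2 ⟨m, h.mA⟩
    omega
  have hB := h.cardB
  have h4 := card_sdiff_add_card_eq_card h.AK
  have hm := h.size m (h.AK h.mA)
  have hmp : m ≠ p := by rintro rfl; exact h.pA h.mA
  simp only [if_true, hmp, if_false] at hm
  -- double count
  have h1 : (X.filter (fun x => f x ∉ A)).card ≤
      ∑ y ∈ X.filter (fun x => f x ∉ A), ((HScls X f m).filter (fun x => G.Adj y x)).card := by
    rw [card_eq_sum_ones]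
    apply sum_le_sum
    intro y hy
    rw [mem_filter] at hy
    have := HS_notfree (h.sep y hy.1 hy.2 m h.mA)
    refine this.trans (card_le_card ?_)
    intro x hx
    simp only [HScls, mem_filter] at hx ⊢
    tauto
  have h2 : ∑ y ∈ X.filter (fun x => f x ∉ A), ((HScls X f m).filter (fun x => G.Adj y x)).card
      = ∑ x ∈ HScls X f m, ((X.filter (fun x => f x ∉ A)).filter (fun y => G.Adj y x)).card := by
    simp only [card_filter _ _]
    rw [sum_comm]
  have h3 : ∀ x ∈ HScls X f m, ((X.filter (fun x => f x ∉ A)).filter (fun y => G.Adj y x)).card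
      ≤ (K \ A).card := by
    intro x hx
    have h5 := h.deg x (mem_filter.1 hx).1
    have h6 : ((X.filter (fun x => f x ∉ A)).filter (fun y => G.Adj y x)).card
        ≤ (X.filter (G.Adj x)).card := by
      apply card_le_card
      intro y hy
      simp only [mem_filter] at hy ⊢
      exact ⟨hy.1.1, hy.2.symm⟩
    omega
  have h7 := sum_le_card_nsmul _ _ _ h3
  rw [smul_eq_mul] at h7
  have h8 : (HScls X f m).card * (K \ A).card ≤ s * (K \ A).card :=
    Nat.mul_le_mul_right _ (by omega)
  rw [mul_comm s] at h8
  omega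

lemma HS_avoid {G : SimpleGraph V} {X : Finset V} {f : V → ℕ} {L : Finset ℕ} {c m W : ℕ}
    (h : Relation.ReflTransGen (HSmv G X f L) c m)
    (hW : ¬ Relation.ReflTransGen (HSmv G X f L) W m) :
    Relation.ReflTransGen (HSmv G X f (L.erase W)) c m := by
  induction h using Relation.ReflTransGen.head_induction_on with
  | refl => exact Relation.ReflTransGen.refl
  | head hab hbm ih =>
    rename_i a b
    have hb : b ≠ W := by rintro rfl; exact hW hbm
    have ha : a ≠ W := by rintro rfl; exact hW (Relation.ReflTransGen.head hab hbm)
    exact Relation.ReflTransGen.head ⟨mem_erase.2 ⟨ha, hab.1⟩, mem_erase.2 ⟨hb, hab.2.1⟩, hab.2.2⟩ ih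

lemma HS_mono {G : SimpleGraph V} {X : Finset V} {f : V → ℕ} {L L' : Finset ℕ} {c m : ℕ}
    (hL : L ⊆ L') (h : Relation.ReflTransGen (HSmv G X f L) c m) :
    Relation.ReflTransGen (HSmv G X f L') c m :=
  Relation.ReflTransGen.mono (fun _ _ h => ⟨hL h.1, hL h.2.1, h.2.2⟩) c m h

/-- terminal classes -/
lemma HSctx.term {G : SimpleGraph V} {X : Finset V} {K A : Finset ℕ} {f : V → ℕ} {m p s : ℕ}
    (h : HSctx G X K A f m p s) : ∃ U ∈ A, ∃ T ⊆ A, U ∉ T ∧ m ∉ T ∧ T.Nonempty ∧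
      (∀ W ∈ T, ∀ C ∈ A, C ≠ W → Relation.ReflTransGen (HSmv G X f (A.erase W)) C m) ∧
      (∀ W ∈ T, ∀ C ∈ A, C ∉ T → C ≠ U → ∀ z ∈ X, f z = W → ¬ HSfree G X f z C) := by
  let τ : ℕ → Finset ℕ := fun U => A.filter
    (fun W => W ≠ U ∧ ¬ Relation.ReflTransGen (HSmv G X f (A.erase U)) W m)
  have hτm : (τ m).Nonempty := by
    obtain ⟨c, hc⟩ := h.two
    rw [mem_erase] at hc
    refine ⟨c, mem_filter.2 ⟨hc.2, hc.1, ?_⟩⟩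
    intro hr
    rcases Relation.ReflTransGen.cases_tail hr with h | ⟨d, -, h⟩
    · exact hc.1 h.symm
    · exact absurd h.2.1 (by simp)
  obtain ⟨U, hU, hmin⟩ := exists_min_image (A.filter (fun U => (τ U).Nonempty)) (fun U => (τ U).card)
    ⟨m, mem_filter.2 ⟨h.mA, hτm⟩⟩
  rw [mem_filter] at hU
  refine ⟨U, hU.1, τ U, filter_subset _ _, by simp [τ], ?_, hU.2, ?_, ?_⟩
  · intro hm
    exact (mem_filter.1 hm).2.2 Relation.ReflTransGen.refl
  · intro W hW C hC hCW
    by_contra hno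
    have hWA := mem_filter.1 hW
    have hCτ : C ∈ τ W := mem_filter.2 ⟨hC, hCW, hno⟩
    have hle := hmin W (mem_filter.2 ⟨hWA.1, ⟨C, hCτ⟩⟩)
    have hss : τ W ⊂ τ U := by
      rw [ssubset_iff_of_subset]
      · exact ⟨W, hW, by simp [τ]⟩
      · intro D hD
        have hD' := mem_filter.1 hD
        refine mem_filter.2 ⟨hD'.1, ?_, ?_⟩
        · rintro rfl
          by_cases hDm : D = m
          · subst hDm; exact hD'.2.2 Relation.ReflTransGen.refl
          obtain ⟨c1, h1, h2, h3⟩ := HS_path_avoid' hDm (h.reach D hD'.1)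
          have hc1W : c1 ≠ W := by rintro rfl; exact hWA.2.2 h3
          refine hD'.2.2 (Relation.ReflTransGen.head
            ⟨mem_erase.2 ⟨hD'.2.1, hD'.1⟩, mem_erase.2 ⟨hc1W, h2.2.1⟩, h2.2.2⟩ ?_)
          exact HS_mono (erase_subset_erase _ (erase_subset _ _)) (HS_avoid h3 hWA.2.2)
        · intro hr
          exact hD'.2.2 (HS_mono (erase_subset_erase _ (erase_subset _ _)) (HS_avoid hr hWA.2.2))
    exact absurd (card_lt_card hss) (by omega)
  · intro W hW C hC hCT hCU z hz hfz hfree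
    have hWA := mem_filter.1 hW
    have hr : Relation.ReflTransGen (HSmv G X f (A.erase U)) C m := by
      by_contra hno
      exact hCT (mem_filter.2 ⟨hC, hCU, hno⟩)
    exact hWA.2.2 (Relation.ReflTransGen.head
      ⟨mem_erase.2 ⟨hWA.2.1, hWA.1⟩, mem_erase.2 ⟨hCU, hC⟩, z, hz, hfz, hfree⟩ hr)

/-- recolouring -/
lemma HS_swap {G : SimpleGraph V} {X B : Finset V} {K A : Finset ℕ} {e g : V → ℕ} {y z : V} {W t : ℕ}
    (hBX : B ⊆ X) (hy : y ∈ B) (hz : z ∈ X) (hzB : z ∉ B) (hAK : A ⊆ K) (hW : W ∈ A) (ht : t ∈ K)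
    (htW : t ≠ W)
    (he : HSProper G ((X \ B).erase z) A e) (hg : HSProper G (B.erase y) (K \ A) g)
    (h1 : ∀ x ∈ (X \ B).erase z, e x = W → ¬ G.Adj y x)
    (h2 : ∀ x ∈ (X \ B).erase z, e x = t → ¬ G.Adj z x)
    (h3 : ∀ x ∈ B.erase y, g x = t → ¬ G.Adj z x) :
    ∃ h : V → ℕ, HSProper G X K h ∧ h z = t ∧ h y = W ∧ (∀ x ∈ B.erase y, h x = g x) ∧
      (∀ x ∈ (X \ B).erase z, h x = e x) ∧
      ∀ d, (HScls X h d).card = (HScls ((X \ B).erase z) e d).card + (HScls (B.erase y) g d).card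
        + (if d = W then 1 else 0) + (if d = t then 1 else 0) := by
  have hyz : y ≠ z := by rintro rfl; exact hzB hy
  let h : V → ℕ := fun x => if x = z then t else if x = y then W else if x ∈ B then g x else e x
  have hhz : h z = t := by simp [h]
  have hhy : h y = W := by simp [h, hyz]
  have hhg : ∀ x ∈ B.erase y, h x = g x := by
    intro x hx
    rw [mem_erase] at hx
    have : x ≠ z := by rintro rfl; exact hzB hx.2
    simp [h, this, hx.1, hx.2]
  have hhe : ∀ x ∈ (X \ B).erase z, h x = e x := by
    intro x hx
    rw [mem_erase, mem_sdiff] at hx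
    have : x ≠ y := by rintro rfl; exact hx.2.2 hy
    simp [h, this, hx.1, hx.2.2]
  have hcases : ∀ x ∈ X, x = z ∨ x = y ∨ x ∈ B.erase y ∨ x ∈ (X \ B).erase z := by
    intro x hx
    simp only [mem_erase, mem_sdiff]
    tauto
  have key : ∀ x ∈ X, ∀ x' ∈ X, G.Adj x x' → h x = h x' →
      (x = z → False) ∧ (x = y → False) ∧ (x ∈ B.erase y → x' ∈ (X \ B).erase z → False) := by
    intro x hx x' hx' hadj heq
    refine ⟨?_, ?_, ?_⟩
    · rintro rfl
      rw [hhz] at heq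
      rcases hcases x' hx' with rfl | rfl | h' | h'
      · exact G.loopless.irrefl _ hadj
      · rw [hhy] at heq; exact htW heq
      · rw [hhg x' h'] at heq; exact h3 x' h' heq.symm hadj
      · rw [hhe x' h'] at heq; exact h2 x' h' heq.symm hadj
    · rintro rfl
      rw [hhy] at heq
      rcases hcases x' hx' with rfl | rfl | h' | h'
      · rw [hhz] at heq; exact htW heq.symm
      · exact G.loopless.irrefl _ hadj
      · rw [hhg x' h'] at heq
        exact (mem_sdiff.1 (hg.1 x' h')).2 (heq ▸ hW)
      · rw [hhe x' h'] at heq; exact h1 x' h' heq.symm hadj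
    · intro h4 h5
      rw [hhg x h4, hhe x' h5] at heq
      exact (mem_sdiff.1 (hg.1 x h4)).2 (heq ▸ he.1 x' h5)
  refine ⟨h, ⟨?_, ?_⟩, hhz, hhy, hhg, hhe, ?_⟩
  · intro x hx
    rcases hcases x hx with rfl | rfl | h' | h'
    · rw [hhz]; exact ht
    · rw [hhy]; exact hAK hW
    · rw [hhg x h']; exact (mem_sdiff.1 (hg.1 x h')).1
    · rw [hhe x h']; exact hAK (he.1 x h')
  · intro x hx x' hx' hadj heq
    have k1 := key x hx x' hx' hadj heq
    have k2 := key x' hx' x hx hadj.symm heq.symm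
    rcases hcases x hx with h4 | h4 | h4 | h4
    · exact k1.1 h4
    · exact k1.2.1 h4
    · rcases hcases x' hx' with h5 | h5 | h5 | h5
      · exact k2.1 h5
      · exact k2.2.1 h5
      · rw [hhg x h4, hhg x' h5] at heq
        exact hg.2 x h4 x' h5 hadj heq
      · exact k1.2.2 h4 h5
    · rcases hcases x' hx' with h5 | h5 | h5 | h5
      · exact k2.1 h5
      · exact k2.2.1 h5
      · exact k2.2.2 h5 h4
      · rw [hhe x h4, hhe x' h5] at heq
        exact he.2 x h4 x' h5 hadj heq
  · intro d
    have hX : X = insert z (insert y (B.erase y ∪ (X \ B).erase z)) := by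
      ext x
      constructor
      · intro hx
        rcases hcases x hx with h4 | h4 | h4 | h4 <;> simp only [mem_insert, mem_union] <;> tauto
      · intro hx
        simp only [mem_insert, mem_union, mem_erase, mem_sdiff] at hx
        rcases hx with rfl | rfl | h4 | h4
        · exact hz
        · exact hBX hy
        · exact hBX h4.2
        · exact h4.2.1
    have hd1 : y ∉ B.erase y ∪ (X \ B).erase z := by
      simp [hy]
    have hd2 : z ∉ insert y (B.erase y ∪ (X \ B).erase z) := by
      simp [hyz.symm, hzB]
    have hd3 : Disjoint (B.erase y) ((X \ B).erase z) := by
      rw [disjoint_left]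
      intro x hx hx'
      simp only [mem_erase, mem_sdiff] at hx hx'
      exact hx'.2.2 hx.2
    have e1 : (HScls X h d).card = ∑ x ∈ X, if h x = d then 1 else 0 := by
      simp [HScls]
    rw [e1]
    conv_lhs => rw [hX]
    rw [sum_insert hd2, sum_insert hd1, sum_union hd3, hhz, hhy]
    have e2 : (∑ x ∈ B.erase y, if h x = d then 1 else 0) = (HScls (B.erase y) g d).card := by
      unfold HScls
      rw [card_filter]
      exact sum_congr rfl (fun x hx => by rw [hhg x hx])
    have e3 : (∑ x ∈ (X \ B).erase z, if h x = d then 1 else 0) = (HScls ((X \ B).erase z) e d).card := by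
      unfold HScls
      rw [card_filter]
      exact sum_congr rfl (fun x hx => by rw [hhe x hx])
    rw [e2, e3]
    simp only [eq_comm (a := t), eq_comm (a := W)]
    ring
end HS2

section HS3
open Classical

/-- Case 1: a movable solo vertex. -/
lemma HSctx.case1 {G : SimpleGraph V} {X : Finset V} {K A : Finset ℕ} {f : V → ℕ} {m p s : ℕ}
    (h : HSctx G X K A f m p s) {W C : ℕ} {y z : V} {g : V → ℕ}
    (hW : W ∈ A) (hC : C ∈ A) (hCW : C ≠ W) (hWm : W ≠ m)
    (hreach : Relation.ReflTransGen (HSmv G X f (A.erase W)) C m)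
    (hy : y ∈ X) (hyA : f y ∉ A) (hz : z ∈ X) (hfz : f z = W)
    (hsolo : X.filter (fun x => G.Adj y x ∧ f x = W) = {z})
    (hfree : HSfree G X f z C)
    (hg : HSProper G ((X.filter (fun x => f x ∉ A)).erase y) (K \ A) g)
    (hgs : ∀ d ∈ K \ A, (HScls ((X.filter (fun x => f x ∉ A)).erase y) g d).card = s) :
    ∃ f', HSProper G X K f' ∧ ∀ d ∈ K, (HScls X f' d).card = s := by
  obtain ⟨e, he, e1, e2, e3, e4⟩ := HS_shift G X K f h.proper m _ (A.erase W) rfl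
    ((erase_subset _ _).trans h.AK) C hreach
  set B := X.filter (fun x => f x ∉ A) with hB
  have heW : ∀ x, e x = W → f x = W := by
    intro x hx
    by_contra hne
    by_cases hxA : f x ∈ A
    · have := e2 x (mem_erase.2 ⟨hne, hxA⟩)
      rw [hx] at this
      simp at this
    · rw [e1 x (fun h => hxA (mem_of_mem_erase h))] at hx
      exact hne hx
  have heA : ∀ x, f x ∈ A → e x ∈ A := by
    intro x hx
    by_cases hxW : f x = W
    · rw [e1 x (by simp [hxW])]; exact hx
    · exact mem_of_mem_erase (e2 x (mem_erase.2 ⟨hxW, hx⟩))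
  have heA' : ∀ x, f x ∉ A → e x ∉ A := by
    intro x hx
    rw [e1 x (fun h => hx (mem_of_mem_erase h))]; exact hx
  have hXB : ∀ x, x ∈ (X \ B).erase z ↔ x ≠ z ∧ x ∈ X ∧ f x ∈ A := by
    intro x
    simp only [hB, mem_erase, mem_sdiff, mem_filter]
    tauto
  obtain ⟨f', hf', -, -, -, -, hs⟩ := HS_swap (G := G) (X := X) (B := B) (K := K) (A := A) (e := e) (g := g)
    (y := y) (z := z) (W := W) (t := C) (filter_subset _ _) (mem_filter.2 ⟨hy, hyA⟩) hz
    (by simp [hB, hfz, hW]) h.AK hW (h.AK hC) hCW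
    ⟨fun x hx => heA x ((hXB x).1 hx).2.2,
      fun x hx x' hx' => he.2 x ((hXB x).1 hx).2.1 x' ((hXB x').1 hx').2.1⟩ hg
    (by
      intro x hx hex hadj
      have hx' := (hXB x).1 hx
      have : x ∈ X.filter (fun x => G.Adj y x ∧ f x = W) := mem_filter.2 ⟨hx'.2.1, hadj, heW x hex⟩
      rw [hsolo, mem_singleton] at this
      exact hx'.1 this)
    (by
      intro x hx hex
      exact hfree x ((hXB x).1 hx).2.1 (e3 x hex))
    (by
      intro x hx hex
      exact absurd hC (hex ▸ (mem_sdiff.1 (hg.1 x hx)).2))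
  refine ⟨f', hf', ?_⟩
  intro d hd
  rw [hs d]
  by_cases hdA : d ∈ A
  · have g0 : (HScls (B.erase y) g d) = ∅ := by
      apply filter_eq_empty_iff.2
      intro x hx hgx
      exact (mem_sdiff.1 (hg.1 x hx)).2 (hgx ▸ hdA)
    have ez : e z = W := by rw [e1 z (by simp [hfz]), hfz]
    have c1 : HScls ((X \ B).erase z) e d = (HScls X e d).erase z := by
      ext x
      simp only [HScls, mem_filter, mem_erase, hXB]
      constructor
      · rintro ⟨⟨h1, h2, h3⟩, h4⟩; exact ⟨h1, h2, h4⟩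
      · rintro ⟨h1, h2, h4⟩
        refine ⟨⟨h1, h2, ?_⟩, h4⟩
        by_contra hno
        exact heA' x hno (h4 ▸ hdA)
    have h4 := e4 d
    have hsz := h.size d hd
    have hdp : d ≠ p := by rintro rfl; exact h.pA hdA
    simp only [hdp, if_false, add_zero] at hsz
    rw [c1, g0, card_empty]
    by_cases hdW : d = W
    · subst hdW
      have hzm : z ∈ HScls X e d := mem_filter.2 ⟨hz, ez⟩
      rw [card_erase_of_mem hzm]
      have := card_pos.2 ⟨z, hzm⟩
      simp only [hCW.symm, hWm, if_false, if_true] at h4 hsz ⊢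
      omega
    · rw [erase_eq_of_notMem (by simp [HScls, ez]; exact fun _ => Ne.symm hdW)]
      simp only [hdW, if_false]
      omega
  · have hdW : d ≠ W := by rintro rfl; exact hdA hW
    have hdC : d ≠ C := by rintro rfl; exact hdA hC
    have c1 : HScls ((X \ B).erase z) e d = ∅ := by
      apply filter_eq_empty_iff.2
      intro x hx hex
      exact hdA (hex ▸ heA x ((hXB x).1 hx).2.2)
    rw [c1, hgs d (mem_sdiff.2 ⟨hd, hdA⟩)]
    simp [hdW, hdC]

/-- Case 2 recolouring. -/
lemma HSctx.case2 {G : SimpleGraph V} {X : Finset V} {K A : Finset ℕ} {f : V → ℕ} {m p s : ℕ}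
    (h : HSctx G X K A f m p s) {W c0 : ℕ} {y y2 z : V} {g : V → ℕ}
    (hW : W ∈ A) (hWm : W ≠ m) (hc0 : c0 ∈ K \ A)
    (hreach : ∀ C ∈ A, C ≠ W → Relation.ReflTransGen (HSmv G X f (A.erase W)) C m)
    (hy : y ∈ X) (hyA : f y ∉ A) (hy2 : y2 ∈ X) (hy2A : f y2 ∉ A) (hyy : y ≠ y2) (hadj : ¬ G.Adj y2 y)
    (hz : z ∈ X) (hfz : f z = W)
    (hsolo : X.filter (fun x => G.Adj y x ∧ f x = W) = {z})
    (hsolo2 : X.filter (fun x => G.Adj y2 x ∧ f x = W) = {z})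
    (hnm : ∀ C ∈ A, C ≠ W → ¬ HSfree G X f z C)
    (hg : HSProper G ((X.filter (fun x => f x ∉ A)).erase y) (K \ A) g)
    (hgs : ∀ d ∈ K \ A, (HScls ((X.filter (fun x => f x ∉ A)).erase y) g d).card = s)
    (hfc : ∀ x ∈ (X.filter (fun x => f x ∉ A)).erase y, g x = c0 → ¬ G.Adj z x) :
    ∃ f', HSProper G X K f' ∧
      (∀ d ∈ K, (HScls X f' d).card + (if d = m then 1 else 0) = s + (if d = c0 then 1 else 0)) ∧
      (∀ c ∈ A, Relation.ReflTransGen (HSmv G X f' K) c m) ∧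
      ∃ c1 ∈ K, c1 ∉ A ∧ Relation.ReflTransGen (HSmv G X f' K) c1 m := by
  set B := X.filter (fun x => f x ∉ A) with hB
  have hc0' := mem_sdiff.1 hc0
  have hXB : ∀ x, x ∈ (X \ B).erase z ↔ x ≠ z ∧ x ∈ X ∧ f x ∈ A := by
    intro x
    simp only [hB, mem_erase, mem_sdiff, mem_filter]
    tauto
  have hc0W : c0 ≠ W := by rintro rfl; exact hc0'.2 hW
  have hyB : y ∈ B := mem_filter.2 ⟨hy, hyA⟩
  obtain ⟨f', hf', f1, f2, f3, f4, hs⟩ := HS_swap (G := G) (X := X) (B := B) (K := K) (A := A) (e := f) (g := g)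
    (y := y) (z := z) (W := W) (t := c0) (filter_subset _ _) hyB hz
    (by simp [hB, hfz, hW]) h.AK hW hc0'.1 hc0W
    ⟨fun x hx => ((hXB x).1 hx).2.2,
      fun x hx x' hx' => h.proper.2 x ((hXB x).1 hx).2.1 x' ((hXB x').1 hx').2.1⟩ hg
    (by
      intro x hx hex hadj
      have hx' := (hXB x).1 hx
      have : x ∈ X.filter (fun x => G.Adj y x ∧ f x = W) := mem_filter.2 ⟨hx'.2.1, hadj, hex⟩
      rw [hsolo, mem_singleton] at this
      exact hx'.1 this)
    (by
      intro x hx hex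
      exact absurd (hex ▸ ((hXB x).1 hx).2.2) hc0'.2)
    hfc
  have hcases : ∀ x ∈ X, x = z ∨ x = y ∨ x ∈ B.erase y ∨ x ∈ (X \ B).erase z := by
    intro x hx
    simp only [mem_erase, mem_sdiff]
    tauto
  -- colour classes in A
  have hcl : ∀ x ∈ X, f' x ∈ A → x ≠ y → x ≠ z ∧ f x = f' x := by
    intro x hx hxA hxy
    rcases hcases x hx with rfl | rfl | h5 | h5
    · rw [f1] at hxA; exact absurd hxA hc0'.2
    · exact absurd rfl hxy
    · rw [f3 x h5] at hxA; exact absurd hxA (mem_sdiff.1 (hg.1 x h5)).2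
    · exact ⟨((hXB x).1 h5).1, (f4 x h5).symm⟩
  have hfr : ∀ d ∈ A, d ≠ W → ∀ v, HSfree G X f v d → HSfree G X f' v d := by
    intro d hd hdW v hv x hx hxd
    have hxy : x ≠ y := by
      rintro rfl; rw [f2] at hxd; exact hdW hxd.symm
    exact hv x hx ((hcl x hx (hxd ▸ hd) hxy).2.trans hxd)
  have hr : ∀ C ∈ A, C ≠ W → Relation.ReflTransGen (HSmv G X f' K) C m := by
    intro C hC hCW
    refine Relation.ReflTransGen.mono ?_ C m (hreach C hC hCW)
    rintro c d ⟨hc, hd, x, hx, hxc, hxf⟩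
    rw [mem_erase] at hc hd
    refine ⟨h.AK hc.2, h.AK hd.2, x, hx, ?_, hfr d hd.2 hd.1 x hxf⟩
    rw [f4 x ((hXB x).2 ⟨?_, hx, hxc ▸ hc.2⟩), hxc]
    rintro rfl
    exact hc.1 (hxc.symm.trans hfz)
  have hrW : Relation.ReflTransGen (HSmv G X f' K) W m := by
    obtain ⟨c1, h1, ⟨h2, h3, x, hx, hxW, hxf⟩, -⟩ := HS_path_avoid' hWm (h.reach W hW)
    refine Relation.ReflTransGen.head (b := c1) ⟨h.AK hW, h.AK h3, x, hx, ?_, hfr c1 h3 h1 x hxf⟩ (hr c1 h3 h1)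
    rw [f4 x ((hXB x).2 ⟨?_, hx, hxW ▸ hW⟩), hxW]
    rintro rfl
    exact hnm c1 h3 h1 hxf
  have hy2B : y2 ∈ B.erase y := mem_erase.2 ⟨hyy.symm, mem_filter.2 ⟨hy2, hy2A⟩⟩
  refine ⟨f', hf', ?_, ?_, g y2, (mem_sdiff.1 (hg.1 y2 hy2B)).1, (mem_sdiff.1 (hg.1 y2 hy2B)).2, ?_⟩
  · intro d hd
    rw [hs d]
    by_cases hdA : d ∈ A
    · have g0 : (HScls (B.erase y) g d) = ∅ := by
        apply filter_eq_empty_iff.2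
        intro x hx hgx
        exact (mem_sdiff.1 (hg.1 x hx)).2 (hgx ▸ hdA)
      have c1 : HScls ((X \ B).erase z) f d = (HScls X f d).erase z := by
        ext x
        simp only [HScls, mem_filter, mem_erase, hXB]
        constructor
        · rintro ⟨⟨h1, h2, h3⟩, h4⟩; exact ⟨h1, h2, h4⟩
        · rintro ⟨h1, h2, h4⟩
          exact ⟨⟨h1, h2, h4 ▸ hdA⟩, h4⟩
      have hsz := h.size d hd
      have hdp : d ≠ p := by rintro rfl; exact h.pA hdA
      have hdc0 : d ≠ c0 := by rintro rfl; exact hc0'.2 hdA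
      simp only [hdp, if_false, add_zero] at hsz
      rw [c1, g0, card_empty]
      simp only [hdc0, if_false]
      by_cases hdW : d = W
      · subst hdW
        have hzm : z ∈ HScls X f d := mem_filter.2 ⟨hz, hfz⟩
        rw [card_erase_of_mem hzm]
        have := card_pos.2 ⟨z, hzm⟩
        simp only [hWm, if_false, if_true] at hsz ⊢
        omega
      · rw [erase_eq_of_notMem (by simp [HScls, hfz]; exact fun _ => Ne.symm hdW)]
        simp only [hdW, if_false]
        omega
    · have hdW : d ≠ W := by rintro rfl; exact hdA hW
      have hdm : d ≠ m := by rintro rfl; exact hdA h.mA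
      have c1 : HScls ((X \ B).erase z) f d = ∅ := by
        apply filter_eq_empty_iff.2
        intro x hx hex
        exact hdA (hex ▸ ((hXB x).1 hx).2.2)
      rw [c1, hgs d (mem_sdiff.2 ⟨hd, hdA⟩)]
      simp [hdW, hdm]
  · intro c hc
    by_cases hcW : c = W
    · rw [hcW]; exact hrW
    · exact hr c hc hcW
  · refine Relation.ReflTransGen.head (b := W)
      ⟨(mem_sdiff.1 (hg.1 y2 hy2B)).1, h.AK hW, y2, hy2, f3 y2 hy2B, ?_⟩ hrW
    intro x hx hxW hxadj
    by_cases hxy : x = y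
    · subst hxy; exact hadj hxadj
    · have h5 := hcl x hx (hxW ▸ hW) hxy
      have : x ∈ X.filter (fun x => G.Adj y2 x ∧ f x = W) := mem_filter.2 ⟨hx, hxadj, h5.2.trans hxW⟩
      rw [hsolo2, mem_singleton] at this
      exact h5.1 this
end HS3

section HS4
open Classical

lemma HS_indep (G : SimpleGraph V) (B : Finset V) : ∃ I ⊆ B, (∀ x ∈ I, ∀ y ∈ I, ¬ G.Adj x y) ∧
    B.card ≤ ∑ x ∈ I, ((B.filter (G.Adj x)).card + 1) := by
  obtain ⟨I, hI, hmax⟩ := exists_max_image (B.powerset.filter (fun I => ∀ x ∈ I, ∀ y ∈ I, ¬ G.Adj x y))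
    card ⟨∅, by simp⟩
  simp only [mem_filter, mem_powerset] at hI hmax
  refine ⟨I, hI.1, hI.2, ?_⟩
  have : B ⊆ I.biUnion (fun x => insert x (B.filter (G.Adj x))) := by
    intro v hv
    rw [mem_biUnion]
    by_contra hno
    push Not at hno
    have hvI : v ∉ I := fun hvI => hno v hvI (mem_insert_self _ _)
    have hva : ∀ x ∈ I, ¬ G.Adj x v := fun x hx ha => hno x hx (by simp [hv, ha])
    have := hmax (insert v I) ⟨insert_subset hv hI.1, ?_⟩
    · rw [card_insert_of_notMem hvI] at this; omega
    · intro x hx y hy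
      rw [mem_insert] at hx hy
      rcases hx with rfl | hx <;> rcases hy with rfl | hy
      · exact G.loopless.irrefl _
      · exact fun h => hva y hy h.symm
      · exact hva x hx
      · exact hI.2 x hx y hy
  calc B.card ≤ _ := card_le_card this
    _ ≤ _ := card_biUnion_le
    _ ≤ _ := sum_le_sum (fun x _ => card_insert_le _ _)

lemma HSctx.count {G : SimpleGraph V} {X : Finset V} {K A : Finset ℕ} {f : V → ℕ} {m p s : ℕ}
    (h : HSctx G X K A f m p s) {U : ℕ} {T : Finset ℕ} (hU : U ∈ A) (hTA : T ⊆ A) (hUT : U ∉ T)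
    (hmT : m ∉ T) (hT : T.Nonempty)
    (hT2 : ∀ W ∈ T, ∀ C ∈ A, C ∉ T → C ≠ U → ∀ z ∈ X, f z = W → ¬ HSfree G X f z C)
    (hno : ∀ z ∈ X, f z ∈ T → ∀ y ∈ X, f y ∉ A →
      X.filter (fun x => G.Adj y x ∧ f x = f z) = {z} → ∀ C ∈ A, C ≠ f z → ¬ HSfree G X f z C) :
    ∃ z ∈ X, f z ∈ T ∧ ((X.filter (fun x => f x ∉ A)).filter (G.Adj z)).card ≤ (K \ A).card ∧
      ∃ y1 ∈ X, f y1 ∉ A ∧ ∃ y2 ∈ X, f y2 ∉ A ∧ y1 ≠ y2 ∧ ¬ G.Adj y2 y1 ∧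
      X.filter (fun x => G.Adj y1 x ∧ f x = f z) = {z} ∧
      X.filter (fun x => G.Adj y2 x ∧ f x = f z) = {z} := by
  set B := X.filter (fun x => f x ∉ A) with hB
  set b := (K \ A).card with hb
  have hkab : b + A.card = K.card := card_sdiff_add_card_eq_card h.AK
  have hBc : B.card = b * s + 1 := h.cardB
  have hTc : T.card + 1 ≤ A.card := by
    rw [← card_insert_of_notMem hUT]
    exact card_le_card (insert_subset hU hTA)
  let P : V → V → Prop := fun y z => X.filter (fun x => G.Adj y x ∧ f x = f z) = {z}
  have hsoloB : ∀ z ∈ X, f z ∈ T → (∃ y ∈ B, P y z) → (B.filter (G.Adj z)).card ≤ b := by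
    rintro z hz hzT ⟨y, hy, hP⟩
    have hy' := mem_filter.1 hy
    have h1 := HS_deg G X A (A.erase (f z)) f (erase_subset _ _) z
    have h2 : ∑ d ∈ A.erase (f z), 1 ≤ ∑ d ∈ A.erase (f z), (X.filter (fun x => G.Adj z x ∧ f x = d)).card :=
      sum_le_sum (fun d hd => HS_notfree (hno z hz hzT y hy'.1 hy'.2 hP d (mem_erase.1 hd).2 (mem_erase.1 hd).1))
    have h3 := h.deg z hz
    simp only [sum_const, smul_eq_mul, mul_one, card_erase_of_mem (hTA hzT)] at h2
    rw [← hB] at h1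
    omega
  have hallB : ∀ z ∈ X, f z ∈ T → (B.filter (G.Adj z)).card ≤ b + T.card := by
    intro z hz hzT
    have h1 := HS_deg G X A ((A \ T).erase U) f ((erase_subset _ _).trans sdiff_subset) z
    have h2 : ∑ d ∈ (A \ T).erase U, 1 ≤ ∑ d ∈ (A \ T).erase U, (X.filter (fun x => G.Adj z x ∧ f x = d)).card := by
      refine sum_le_sum (fun d hd => HS_notfree ?_)
      simp only [mem_erase, mem_sdiff] at hd
      exact hT2 (f z) hzT d hd.2.1 hd.2.2 hd.1 z hz rfl
    have h3 := h.deg z hz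
    have h4 := card_sdiff_add_card_eq_card hTA
    simp only [sum_const, smul_eq_mul, mul_one,
      card_erase_of_mem (mem_sdiff.2 ⟨hU, hUT⟩)] at h2
    rw [← hB] at h1
    omega
  have hsz : ∀ W ∈ T, (HScls X f W).card = s := by
    intro W hW
    have h1 := h.size W (h.AK (hTA hW))
    have h2 : W ≠ m := by rintro rfl; exact hmT hW
    have h3 : W ≠ p := by rintro rfl; exact h.pA (hTA hW)
    simpa [h2, h3] using h1
  have hNpos : ∀ y ∈ B, ∀ W ∈ A, 1 ≤ (X.filter (fun x => G.Adj y x ∧ f x = W)).card := by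
    intro y hy W hW
    have hy' := mem_filter.1 hy
    exact HS_notfree (h.sep y hy'.1 hy'.2 W hW)
  -- per class
  have hper : ∀ y ∈ B, ∀ W ∈ A, 2 ≤ (X.filter (fun x => G.Adj y x ∧ f x = W)).card
      + ((X.filter (fun x => f x ∈ T ∧ P y x)).filter (fun x => f x = W)).card ∨ W ∉ T := by
    intro y hy W hW
    by_cases hWT : W ∈ T
    swap
    · exact Or.inr hWT
    left
    have h1 := hNpos y hy W hW
    by_cases h2 : (X.filter (fun x => G.Adj y x ∧ f x = W)).card = 1
    · obtain ⟨z, hz⟩ := card_eq_one.1 h2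
      have hzm : z ∈ X.filter (fun x => G.Adj y x ∧ f x = W) := by rw [hz]; simp
      rw [mem_filter] at hzm
      have : 0 < ((X.filter (fun x => f x ∈ T ∧ P y x)).filter (fun x => f x = W)).card := by
        refine card_pos.2 ⟨z, ?_⟩
        simp only [mem_filter]
        refine ⟨⟨hzm.1, hzm.2.2 ▸ hWT, ?_⟩, hzm.2.2⟩
        show X.filter (fun x => G.Adj y x ∧ f x = f z) = {z}
        rw [hzm.2.2]; exact hz
      omega
    · omega
  -- t > b
  have htb : b < T.card := by
    by_contra hle
    push Not at hle
    obtain ⟨W, hW⟩ := hT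
    let w : V → ℕ := fun z => if ∃ y ∈ B, P y z then 2 else 1
    have h1 : ∑ y ∈ B, 2 ≤ ∑ y ∈ B, ∑ z ∈ HScls X f W, if G.Adj y z then w z else 0 := by
      apply sum_le_sum
      intro y hy
      have hN := hNpos y hy W (hTA hW)
      rw [← sum_filter]
      have hset : (HScls X f W).filter (fun z => G.Adj y z) = X.filter (fun x => G.Adj y x ∧ f x = W) := by
        ext x; simp only [HScls, mem_filter]; tauto
      rw [hset]
      by_cases h2 : (X.filter (fun x => G.Adj y x ∧ f x = W)).card = 1
      · obtain ⟨z, hz⟩ := card_eq_one.1 h2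
        have hzm : z ∈ X.filter (fun x => G.Adj y x ∧ f x = W) := by rw [hz]; simp
        rw [mem_filter] at hzm
        rw [hz, sum_singleton]
        have : ∃ y ∈ B, P y z := by
          refine ⟨y, hy, ?_⟩
          show X.filter (fun x => G.Adj y x ∧ f x = f z) = {z}
          rw [hzm.2.2]; exact hz
        simp only [w, if_pos this]; exact le_refl _
      · calc 2 ≤ (X.filter (fun x => G.Adj y x ∧ f x = W)).card := by omega
          _ = ∑ z ∈ X.filter (fun x => G.Adj y x ∧ f x = W), 1 := by simp
          _ ≤ _ := by
            apply sum_le_sum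
            intro z _
            simp only [w]
            split_ifs <;> omega
    rw [sum_comm] at h1
    have h2 : ∀ z ∈ HScls X f W, (∑ y ∈ B, if G.Adj y z then w z else 0) ≤ 2 * b := by
      intro z hz
      have hz' := mem_filter.1 hz
      have hzT : f z ∈ T := by rw [hz'.2]; exact hW
      have h3 : (∑ y ∈ B, if G.Adj y z then w z else 0) = (B.filter (G.Adj z)).card * w z := by
        rw [← sum_filter, sum_const, smul_eq_mul]
        congr 2
        ext x; simp [G.adj_comm]
      rw [h3]
      by_cases hs : ∃ y ∈ B, P y z
      · have := hsoloB z hz'.1 hzT hs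
        simp only [w, if_pos hs]
        omega
      · have := hallB z hz'.1 hzT
        simp only [w, if_neg hs]
        omega
    have h4 := sum_le_card_nsmul _ _ _ h2
    rw [hsz W hW, smul_eq_mul] at h4
    simp only [sum_const, smul_eq_mul, hBc] at h1
    have h5 : s * (2 * b) = 2 * (b * s) := by ring
    omega
  -- solo lower bound
  have hsl : ∀ y ∈ B, (B.filter (G.Adj y)).card + T.card + 1 ≤
      (X.filter (fun x => f x ∈ T ∧ P y x)).card + b := by
    intro y hy
    have hy' := mem_filter.1 hy
    have h1 := HS_deg G X A A f (Subset.refl _) y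
    rw [← hB] at h1
    have h2 := h.deg y hy'.1
    have h3 : (X.filter (fun x => f x ∈ T ∧ P y x)).card
        = ∑ W ∈ T, ((X.filter (fun x => f x ∈ T ∧ P y x)).filter (fun x => f x = W)).card := by
      apply card_eq_sum_card_fiberwise
      intro x hx
      simp at hx ⊢
      exact hx.2.1
    have h4 : ∑ W ∈ T, 2 ≤ ∑ W ∈ T, ((X.filter (fun x => G.Adj y x ∧ f x = W)).card
      + ((X.filter (fun x => f x ∈ T ∧ P y x)).filter (fun x => f x = W)).card) := by
      apply sum_le_sum
      intro W hW
      exact (hper y hy W (hTA hW)).resolve_right (fun h => h hW)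
    rw [sum_add_distrib, ← h3] at h4
    have h5 := sum_sdiff (f := fun W => (X.filter (fun x => G.Adj y x ∧ f x = W)).card) hTA
    have h6 : ∑ W ∈ A \ T, 1 ≤ ∑ W ∈ A \ T, (X.filter (fun x => G.Adj y x ∧ f x = W)).card :=
      sum_le_sum (fun W hW => hNpos y hy W (mem_sdiff.1 hW).1)
    have h7 := card_sdiff_add_card_eq_card hTA
    simp only [sum_const, smul_eq_mul, mul_one] at h4 h6
    omega
  obtain ⟨I, hIB, hI, hIc⟩ := HS_indep G B
  have hIs : s < I.card := by
    have h1 : ∑ x ∈ I, ((B.filter (G.Adj x)).card + 1) ≤ I.card • b := by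
      apply sum_le_card_nsmul
      intro x hx
      have hx' := mem_filter.1 (hIB hx)
      have := h.degB x hx'.1 hx'.2
      rw [← hB, ← hb] at this
      omega
    rw [smul_eq_mul] at h1
    by_contra hle
    push Not at hle
    have := Nat.mul_le_mul_right b hle
    rw [mul_comm s] at this
    omega
  have hsum : T.card * s < ∑ y ∈ I, (X.filter (fun x => f x ∈ T ∧ P y x)).card := by
    have h1 : ∑ y ∈ I, ((B.filter (G.Adj y)).card + T.card + 1) ≤
        ∑ y ∈ I, ((X.filter (fun x => f x ∈ T ∧ P y x)).card + b) :=
      sum_le_sum (fun y hy => hsl y (hIB hy))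
    have h2 : ∑ y ∈ I, ((B.filter (G.Adj y)).card + T.card + 1)
        = ∑ y ∈ I, ((B.filter (G.Adj y)).card + 1) + I.card * T.card := by
      rw [← smul_eq_mul, ← sum_const, ← sum_add_distrib]
      exact sum_congr rfl (fun x _ => by ring)
    have h6 : ∑ y ∈ I, ((X.filter (fun x => f x ∈ T ∧ P y x)).card + b)
        = ∑ y ∈ I, (X.filter (fun x => f x ∈ T ∧ P y x)).card + I.card * b := by
      rw [sum_add_distrib, sum_const, smul_eq_mul]
    rw [h2, h6] at h1
    obtain ⟨j, hj⟩ := Nat.exists_eq_add_of_lt htb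
    have h3 : I.card * T.card = I.card * b + I.card * (j + 1) := by rw [hj]; ring
    have h4 : T.card * s = b * s + (j + 1) * s := by rw [hj]; ring
    have h5 : (j + 1) * s ≤ I.card * (j + 1) := by
      rw [mul_comm]; exact Nat.mul_le_mul_right _ hIs.le
    omega
  -- pigeonhole
  have hXT : (X.filter (fun x => f x ∈ T)).card = T.card * s := by
    rw [card_eq_sum_card_fiberwise (f := f) (t := T)]
    · rw [← smul_eq_mul, ← sum_const]
      apply sum_congr rfl
      intro W hW
      rw [← hsz W hW]
      congr 1
      ext x
      simp only [HScls, mem_filter]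
      constructor
      · rintro ⟨⟨h1, h2⟩, h3⟩; exact ⟨h1, h3⟩
      · rintro ⟨h1, h3⟩; exact ⟨⟨h1, h3 ▸ hW⟩, h3⟩
    · intro x hx
      simp at hx ⊢
      exact hx.2
  have hdc : ∑ y ∈ I, (X.filter (fun x => f x ∈ T ∧ P y x)).card
      = ∑ z ∈ X.filter (fun x => f x ∈ T), (I.filter (fun y => P y z)).card := by
    have : ∀ y, (X.filter (fun x => f x ∈ T ∧ P y x)) = (X.filter (fun x => f x ∈ T)).filter (fun x => P y x) := by
      intro y; rw [filter_filter]
    simp only [this, card_filter (fun x => P _ x)]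
    rw [sum_comm]
    simp only [card_filter (fun y => P y _)]
  rw [hdc, ← hXT] at hsum
  have hex : ∃ z ∈ X.filter (fun x => f x ∈ T), 1 < (I.filter (fun y => P y z)).card := by
    by_contra hcon
    push Not at hcon
    have := sum_le_card_nsmul _ _ _ hcon
    simp only [smul_eq_mul, mul_one] at this
    omega
  obtain ⟨z, hz, hz2⟩ := hex
  obtain ⟨y1, hy1, y2, hy2, hne⟩ := one_lt_card.1 hz2
  rw [mem_filter] at hz hy1 hy2
  have hy1B := mem_filter.1 (hIB hy1.1)
  have hy2B := mem_filter.1 (hIB hy2.1)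
  exact ⟨z, hz.1, hz.2, hsoloB z hz.1 hz.2 ⟨y1, hIB hy1.1, hy1.2⟩, y1, hy1B.1, hy1B.2, y2, hy2B.1, hy2B.2, hne,
    hI y2 hy2.1 y1 hy1.1, hy1.2, hy2.2⟩
end HS4

section HS5
open Classical

/-- Hajnal-Szemeredi for `k` colours. -/
def HSstmt (V : Type*) (k : ℕ) : Prop :=
  ∀ (s : ℕ) (G : SimpleGraph V) (X : Finset V) (K : Finset ℕ), K.card = k → X.card = s * k →
    (∀ v ∈ X, (X.filter (G.Adj v)).card < k) →
    ∃ f, HSProper G X K f ∧ ∀ c ∈ K, (HScls X f c).card = s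

lemma HS_near (k : ℕ) (IH : ∀ k' < k, HSstmt V k') (s : ℕ) (G : SimpleGraph V) (X : Finset V)
    (K : Finset ℕ) (hK : K.card = k) (hdeg : ∀ v ∈ X, (X.filter (G.Adj v)).card < k) (m : ℕ) (hm : m ∈ K) :
    ∀ (N : ℕ) (f : V → ℕ) (p : ℕ), HSProper G X K f → p ∈ K →
      (∀ d ∈ K, (HScls X f d).card + (if d = m then 1 else 0) = s + (if d = p then 1 else 0)) →
      (K.filter (fun c => ¬ Relation.ReflTransGen (HSmv G X f K) c m)).card = N →
      ∃ f, HSProper G X K f ∧ ∀ c ∈ K, (HScls X f c).card = s := by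
  intro N
  induction N using Nat.strong_induction_on with
  | _ N ihN =>
  intro f p hf hp hsize hN
  by_cases hpr : Relation.ReflTransGen (HSmv G X f K) p m
  · obtain ⟨f', hf', -, -, -, h4⟩ := HS_shift G X K f hf m _ K rfl (Subset.refl _) p hpr
    refine ⟨f', hf', fun c hc => ?_⟩
    have h5 := h4 c
    have h6 := hsize c hc
    omega
  set A := K.filter (fun c => Relation.ReflTransGen (HSmv G X f K) c m) with hA
  have hAK : A ⊆ K := filter_subset _ _
  have hreach : ∀ c ∈ A, Relation.ReflTransGen (HSmv G X f A) c m := by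
    intro c hc
    have := (mem_filter.1 hc).2
    clear hc
    induction this using Relation.ReflTransGen.head_induction_on with
    | refl => exact Relation.ReflTransGen.refl
    | head hab hbm ih =>
      exact Relation.ReflTransGen.head ⟨mem_filter.2 ⟨hab.1, Relation.ReflTransGen.head hab hbm⟩,
        mem_filter.2 ⟨hab.2.1, hbm⟩, hab.2.2⟩ ih
  have ctx : HSctx G X K A f m p s := by
    refine ⟨hf, hAK, mem_filter.2 ⟨hm, Relation.ReflTransGen.refl⟩, hp,
      fun h => hpr (mem_filter.1 h).2, hsize, hreach, ?_, ?_⟩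
    · intro y hy hyA d hd hfree
      exact hyA (mem_filter.2 ⟨hf.1 y hy, Relation.ReflTransGen.head
        ⟨hf.1 y hy, hAK hd, y, hy, rfl, hfree⟩ (mem_filter.1 hd).2⟩)
    · rw [hK]; exact hdeg
  have hNA : N = (K \ A).card := by
    rw [← hN]
    congr 1
    ext c
    simp only [hA, mem_filter, mem_sdiff]
    tauto
  have hB := ctx.cardB
  have hAc := card_sdiff_add_card_eq_card hAK
  have hApos : 0 < A.card := card_pos.2 ⟨m, ctx.mA⟩
  have hg : ∀ y ∈ X, f y ∉ A → ∃ g, HSProper G ((X.filter (fun x => f x ∉ A)).erase y) (K \ A) g ∧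
      ∀ d ∈ K \ A, (HScls ((X.filter (fun x => f x ∉ A)).erase y) g d).card = s := by
    intro y hy hyA
    have hyB : y ∈ X.filter (fun x => f x ∉ A) := mem_filter.2 ⟨hy, hyA⟩
    apply IH (K \ A).card (by omega) s G _ (K \ A) rfl
    · rw [card_erase_of_mem hyB, hB]
      rw [mul_comm]; rfl
    · intro v hv
      have hv' := mem_filter.1 (mem_of_mem_erase hv)
      exact lt_of_le_of_lt (card_le_card (filter_subset_filter _ (erase_subset _ _)))
        (ctx.degB v hv'.1 hv'.2)
  obtain ⟨U, hU, T, hTA, hUT, hmT, hT, hT1, hT2⟩ := ctx.term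
  by_cases hcase : ∃ z ∈ X, f z ∈ T ∧ ∃ y ∈ X, f y ∉ A ∧
      X.filter (fun x => G.Adj y x ∧ f x = f z) = {z} ∧ ∃ C ∈ A, C ≠ f z ∧ HSfree G X f z C
  · obtain ⟨z, hz, hzT, y, hy, hyA, hsolo, C, hC, hCz, hfree⟩ := hcase
    obtain ⟨g, hg1, hg2⟩ := hg y hy hyA
    exact ctx.case1 (hTA hzT) hC hCz (fun h => hmT (h ▸ hzT)) (hT1 _ hzT C hC hCz) hy hyA hz rfl hsolo hfree
      hg1 hg2
  push Not at hcase
  obtain ⟨z, hz, hzT, hzd, y1, hy1, hy1A, y2, hy2, hy2A, hne, hadj, hs1, hs2⟩ :=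
    ctx.count hU hTA hUT hmT hT hT2 hcase
  obtain ⟨g, hg1, hg2⟩ := hg y1 hy1 hy1A
  have hzy : G.Adj y1 z := by
    have : z ∈ X.filter (fun x => G.Adj y1 x ∧ f x = f z) := by rw [hs1]; simp
    exact (mem_filter.1 this).2.1
  have hc0 : ∃ c0 ∈ K \ A, ∀ x ∈ (X.filter (fun x => f x ∉ A)).erase y1, g x = c0 → ¬ G.Adj z x := by
    by_contra hcon
    push Not at hcon
    have h1 : K \ A ⊆ ((((X.filter (fun x => f x ∉ A)).filter (G.Adj z)).erase y1).image g) := by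
      intro c hc
      obtain ⟨x, hx, hxc, hzx⟩ := hcon c hc
      rw [mem_erase] at hx
      exact mem_image.2 ⟨x, mem_erase.2 ⟨hx.1, mem_filter.2 ⟨hx.2, hzx⟩⟩, hxc⟩
    have h2 := (card_le_card h1).trans card_image_le
    have hmem : y1 ∈ (X.filter (fun x => f x ∉ A)).filter (G.Adj z) :=
      mem_filter.2 ⟨mem_filter.2 ⟨hy1, hy1A⟩, hzy.symm⟩
    rw [card_erase_of_mem hmem] at h2
    have := card_pos.2 ⟨_, hmem⟩
    omega
  obtain ⟨c0, hc0, hfc⟩ := hc0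
  obtain ⟨f', hf', hsz', hr', c1, hc1, hc1A, hrc1⟩ := ctx.case2 (hTA hzT) (fun h => hmT (h ▸ hzT)) hc0
    (hT1 _ hzT) hy1 hy1A hy2 hy2A hne hadj hz rfl hs1 hs2 (hcase z hz hzT y1 hy1 hy1A hs1) hg1 hg2 hfc
  refine ihN _ ?_ f' c0 hf' (mem_sdiff.1 hc0).1 hsz' rfl
  rw [hNA]
  apply card_lt_card
  rw [ssubset_iff_of_subset]
  · exact ⟨c1, mem_sdiff.2 ⟨hc1, hc1A⟩, fun h => (mem_filter.1 h).2 hrc1⟩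
  · intro c hc
    rw [mem_filter] at hc
    exact mem_sdiff.2 ⟨hc.1, fun h => hc.2 (hr' c h)⟩

lemma HS_partition (s : ℕ) (K : Finset ℕ) : ∀ X : Finset V, X.card = s * K.card →
    ∃ f : V → ℕ, (∀ x ∈ X, f x ∈ K) ∧ ∀ c ∈ K, (HScls X f c).card = s := by
  induction K using Finset.induction_on with
  | empty =>
    intro X hX
    simp at hX
    subst hX
    exact ⟨fun _ => 0, by simp, by simp⟩
  | insert a K ha ih =>
    intro X hX
    rw [card_insert_of_notMem ha] at hX
    obtain ⟨Y, hY, hYc⟩ := exists_subset_card_eq (s := X) (n := s) (by rw [hX]; nlinarith)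
    obtain ⟨f, h1, h2⟩ := ih (X \ Y) (by
      have := card_sdiff_add_card_eq_card hY
      rw [hX, hYc, mul_add] at this
      omega)
    refine ⟨fun x => if x ∈ Y then a else f x, ?_, ?_⟩
    · intro x hx
      by_cases hxY : x ∈ Y
      · simp [hxY]
      · simp only [hxY, if_false]
        exact mem_insert_of_mem (h1 x (mem_sdiff.2 ⟨hx, hxY⟩))
    · intro c hc
      by_cases hca : c = a
      · subst hca
        rw [← hYc]
        congr 1
        ext x
        simp only [HScls, mem_filter]
        constructor
        · rintro ⟨hx, hxc⟩
          by_contra hxY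
          simp only [hxY, if_false] at hxc
          exact ha (hxc ▸ h1 x (mem_sdiff.2 ⟨hx, hxY⟩))
        · intro hx
          exact ⟨hY hx, by simp [hx]⟩
      · have hcK : c ∈ K := (mem_insert.1 hc).resolve_left hca
        rw [← h2 c hcK]
        congr 1
        ext x
        simp only [HScls, mem_filter, mem_sdiff]
        by_cases hxY : x ∈ Y
        · simp [hxY, Ne.symm hca]
        · simp [hxY]

theorem HS_main : ∀ k, HSstmt V k := by
  intro k
  induction k using Nat.strong_induction_on with
  | _ k IH =>
  intro s G X K hK hX hdeg
  -- graph restricted to edges inside Y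
  let GY : Finset V → SimpleGraph V := fun Y =>
    { Adj := fun x y => G.Adj x y ∧ x ∈ Y ∧ y ∈ Y
      symm := ⟨fun x y h => ⟨h.1.symm, h.2.2, h.2.1⟩⟩
      loopless := ⟨fun x h => G.loopless.irrefl x h.1⟩ }
  have hdegY : ∀ Y, ∀ v ∈ X, (X.filter ((GY Y).Adj v)).card < k := by
    intro Y v hv
    refine lt_of_le_of_lt (card_le_card ?_) (hdeg v hv)
    intro x hx
    rw [mem_filter] at hx ⊢
    exact ⟨hx.1, hx.2.1⟩
  have key : ∀ Y : Finset V, Y ⊆ X → ∃ f, HSProper (GY Y) X K f ∧ ∀ c ∈ K, (HScls X f c).card = s := by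
    intro Y
    induction Y using Finset.induction_on with
    | empty =>
      intro _
      obtain ⟨f, h1, h2⟩ := HS_partition s K X (by rw [hK]; exact hX)
      exact ⟨f, ⟨h1, fun x _ y _ h => absurd h.2.1 (by simp)⟩, h2⟩
    | insert u Y hu ih =>
      intro hYX
      obtain ⟨f, hf, hfs⟩ := ih ((subset_insert _ _).trans hYX)
      have huX : u ∈ X := hYX (mem_insert_self _ _)
      -- find a free colour
      have hfc : ∃ c ∈ K, ∀ x ∈ X, f x = c → ¬ (GY (insert u Y)).Adj u x := by
        by_contra hcon
        push Not at hcon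
        have h1 : K ⊆ (X.filter ((GY (insert u Y)).Adj u)).image f := by
          intro c hc
          obtain ⟨x, hx, hxc, hux⟩ := hcon c hc
          exact mem_image.2 ⟨x, mem_filter.2 ⟨hx, hux⟩, hxc⟩
        have h2 := (card_le_card h1).trans card_image_le
        have := hdegY (insert u Y) u huX
        omega
      obtain ⟨c, hc, hcf⟩ := hfc
      have hadj : ∀ x y, x ≠ u → y ≠ u → (GY (insert u Y)).Adj x y → (GY Y).Adj x y := by
        rintro x y hx hy ⟨h1, h2, h3⟩
        exact ⟨h1, (mem_insert.1 h2).resolve_left hx, (mem_insert.1 h3).resolve_left hy⟩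
      have hprop : HSProper (GY (insert u Y)) X K (Function.update f u c) := by
        refine ⟨?_, ?_⟩
        · intro x hx
          by_cases hxu : x = u
          · subst hxu; simpa using hc
          · simpa [hxu] using hf.1 x hx
        · intro x hx y hy hxy
          by_cases hxu : x = u
          · subst hxu
            rw [Function.update_self, Function.update_of_ne hxy.ne']
            intro he
            exact hcf y hy he.symm hxy
          · by_cases hyu : y = u
            · subst hyu
              rw [Function.update_self, Function.update_of_ne hxu]
              intro he
              exact hcf x hx he hxy.symm
            · rw [Function.update_of_ne hxu, Function.update_of_ne hyu]
              exact hf.2 x hx y hy (hadj x y hxu hyu hxy)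
      refine HS_near k IH s (GY (insert u Y)) X K hK (fun v hv => by convert hdegY (insert u Y) v hv) (f u) (hf.1 u huX) _ _ c hprop hc ?_ rfl
      intro d hd
      have h0 := hfs d hd
      by_cases hcu : c = f u
      · have : Function.update f u c = f := by rw [hcu]; exact Function.update_eq_self u f
        rw [this, h0, hcu]
      by_cases hdc : d = c
      · subst hdc
        have : HScls X (Function.update f u d) d = insert u (HScls X f d) := by
          ext x
          by_cases hxu : x = u
          · subst hxu; simp [HScls, huX]
          · simp [HScls, hxu]
        rw [this, card_insert_of_notMem (by simp [HScls, Ne.symm hcu]), h0]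
        simp [hcu]
      · by_cases hdu : d = f u
        · have : HScls X (Function.update f u c) d = (HScls X f d).erase u := by
            ext x
            by_cases hxu : x = u
            · subst hxu; simp [HScls, Ne.symm hdc]
            · simp [HScls, hxu]
          have hmem : u ∈ HScls X f d := mem_filter.2 ⟨huX, hdu.symm⟩
          rw [this, card_erase_of_mem hmem, h0]
          have := card_pos.2 ⟨u, hmem⟩
          simp only [hdu, if_true, Ne.symm hcu, if_false]
          omega
        · have : HScls X (Function.update f u c) d = HScls X f d := by
            ext x
            by_cases hxu : x = u
            · subst hxu; simp [HScls, Ne.symm hdc, Ne.symm hdu]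
            · simp [HScls, hxu]
          rw [this, h0]
          simp [hdc, hdu]
  obtain ⟨f, hf, hfs⟩ := key X (Subset.refl _)
  exact ⟨f, ⟨hf.1, fun x hx y hy h => hf.2 x hx y hy ⟨h, hx, hy⟩⟩, hfs⟩
end HS5

section ST
open Classical

lemma HS_tiling [DecidableEq V] (G : SimpleGraph V) (r : ℕ) (W : Finset V) (hr : 1 ≤ r) (hd : r ∣ W.card)
    (hdeg : ∀ v ∈ W, (W.filter (fun u => ¬ G.Adj v u)).card * r ≤ W.card) :
    ∃ T, IsKrTilingOn G r T W := by
  obtain ⟨k, hk⟩ := hd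
  obtain ⟨f, hf, hs⟩ := HS_main (V := V) k r Gᶜ W (range k) (card_range k) hk (by
    intro v hv
    have h1 := hdeg v hv
    have h2 : (W.filter (Gᶜ.Adj v)).card < (W.filter (fun u => ¬ G.Adj v u)).card := by
      apply card_lt_card
      rw [ssubset_iff_of_subset]
      · exact ⟨v, by simp [hv], by simp⟩
      · intro x hx
        simp only [mem_filter, SimpleGraph.compl_adj] at hx ⊢
        exact ⟨hx.1, hx.2.2⟩
    rw [hk, mul_comm] at h1
    have h3 := Nat.le_of_mul_le_mul_left h1 hr
    have h4 := Nat.lt_of_lt_of_le h2 h3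
    convert h4)
  refine ⟨(range k).image (HScls W f), ?_, ?_, ?_⟩
  · intro K hK
    obtain ⟨c, hc, rfl⟩ := mem_image.1 hK
    rw [SimpleGraph.isNClique_iff]
    refine ⟨?_, hs c hc⟩
    intro x hx y hy hxy
    simp only [HScls, mem_coe, mem_filter] at hx hy
    by_contra hno
    exact hf.2 x hx.1 y hy.1 ((SimpleGraph.compl_adj _ _ _).2 ⟨hxy, hno⟩) (hx.2.trans hy.2.symm)
  · intro K hK K' hK' hne
    obtain ⟨c, hc, rfl⟩ := mem_image.1 hK
    obtain ⟨c', hc', rfl⟩ := mem_image.1 hK'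
    rw [disjoint_left]
    intro x hx hx'
    simp only [HScls, mem_filter] at hx hx'
    exact hne (by rw [← hx.2, hx'.2])
  · ext x
    simp only [mem_biUnion, mem_image, id]
    constructor
    · rintro ⟨K, ⟨c, -, rfl⟩, hx⟩
      exact (mem_filter.1 hx).1
    · intro hx
      exact ⟨_, ⟨f x, hf.1 x hx, rfl⟩, mem_filter.2 ⟨hx, rfl⟩⟩

/-- `K` is an `r`-clique inside `W`. -/
def TC (G : SimpleGraph V) (r : ℕ) (W K : Finset V) : Prop :=
  K ⊆ W ∧ K.card = r ∧ ∀ x ∈ K, ∀ y ∈ K, x ≠ y → G.Adj x y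

lemma TC.nclique {G : SimpleGraph V} {r : ℕ} {W K : Finset V} (h : TC G r W K) : G.IsNClique r K := by
  rw [SimpleGraph.isNClique_iff]
  exact ⟨fun x hx y hy hxy => h.2.2 x hx y hy hxy, h.2.1⟩

lemma TC_of_nclique {G : SimpleGraph V} {r : ℕ} {W K : Finset V} (hW : K ⊆ W) (h : G.IsNClique r K) :
    TC G r W K := by
  rw [SimpleGraph.isNClique_iff] at h
  exact ⟨hW, h.2, fun x hx y hy hxy => h.1 hx hy hxy⟩

lemma TC.insert [DecidableEq V] {G : SimpleGraph V} {r : ℕ} {W K : Finset V} {v : V} (h : TC G r W K) (hv : v ∈ W)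
    (hadj : ∀ x ∈ K, G.Adj v x) : TC G (r + 1) W (insert v K) := by
  have hvK : v ∉ K := fun hvK => G.loopless.irrefl _ (hadj v hvK)
  refine ⟨insert_subset hv h.1, by rw [card_insert_of_notMem hvK, h.2.1], ?_⟩
  intro x hx y hy hxy
  rw [mem_insert] at hx hy
  rcases hx with rfl | hx <;> rcases hy with rfl | hy
  · exact absurd rfl hxy
  · exact hadj y hy
  · exact (hadj x hx).symm
  · exact h.2.2 x hx y hy hxy

lemma TC.sub {G : SimpleGraph V} {r s : ℕ} {W K L : Finset V} (h : TC G r W K) (hL : L ⊆ K)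
    (hc : L.card = s) : TC G s W L :=
  ⟨hL.trans h.1, hc, fun x hx y hy hxy => h.2.2 x (hL hx) y (hL hy) hxy⟩

/-- robust common neighbours -/
def Rob (G : SimpleGraph V) (r C : ℕ) (W : Finset V) : Prop :=
  ∀ S ⊆ W, S.card ≤ r → ∀ F : Finset V, F.card ≤ C → ∃ z ∈ W, z ∉ F ∧ ∀ s ∈ S, G.Adj s z

lemma Rob.ext [DecidableEq V] {G : SimpleGraph V} {r C : ℕ} {W : Finset V} (h : Rob G r C W) (F : Finset V) (hF : F.card ≤ C) :
    ∀ (j : ℕ) (S : Finset V), S ⊆ W → S.card + j ≤ r + 1 →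
      ∃ Q, TC G j W Q ∧ Disjoint Q F ∧ ∀ s ∈ S, ∀ x ∈ Q, G.Adj s x := by
  intro j
  induction j with
  | zero =>
    intro S _ _
    exact ⟨∅, ⟨by simp, by simp, by simp⟩, by simp, by simp⟩
  | succ j ih =>
    intro S hS hc
    obtain ⟨z, hz, hzF, hzS⟩ := h S hS (by omega) F hF
    have hzS' : z ∉ S := fun hm => G.loopless.irrefl _ (hzS z hm)
    obtain ⟨Q, hQ, hQF, hQS⟩ := ih (insert z S) (insert_subset hz hS)
      (by rw [card_insert_of_notMem hzS']; omega)
    refine ⟨insert z Q, hQ.insert hz (hQS z (mem_insert_self _ _)), ?_, ?_⟩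
    · rw [disjoint_insert_left]; exact ⟨hzF, hQF⟩
    · intro s hs x hx
      rcases mem_insert.1 hx with rfl | hx
      · exact hzS s hs
      · exact hQS s (mem_insert_of_mem hs) x hx

lemma tight_conn [DecidableEq V] {G : SimpleGraph V} : ∀ (r : ℕ) (W : Finset V), Rob G r 0 W → ∀ φ : Finset V → ℤ,
    (∀ Q u v, u ∉ Q → v ∉ Q → TC G r W (insert u Q) → TC G r W (insert v Q) →
      φ (insert u Q) = φ (insert v Q)) →
    ∀ K K', TC G r W K → TC G r W K' → φ K = φ K' := by
  intro r
  induction r with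
  | zero =>
    intro W _ φ _ K K' hK hK'
    rw [card_eq_zero.1 hK.2.1, card_eq_zero.1 hK'.2.1]
  | succ r ih =>
    intro W hR φ hφ K K' hK hK'
    have link : ∀ v ∈ W, ∀ K K', TC G (r + 1) W K → TC G (r + 1) W K' → v ∈ K → v ∈ K' → φ K = φ K' := by
      intro v hv K K' hK hK' hvK hvK'
      have hsub : ∀ L, TC G (r + 1) W L → v ∈ L → TC G r (W.filter (G.Adj v)) (L.erase v) := by
        intro L hL hvL
        refine ⟨?_, by rw [card_erase_of_mem hvL, hL.2.1]; rfl, fun x hx y hy hxy =>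
          hL.2.2 x (mem_of_mem_erase hx) y (mem_of_mem_erase hy) hxy⟩
        intro x hx
        rw [mem_erase] at hx
        exact mem_filter.2 ⟨hL.1 hx.2, hL.2.2 v hvL x hx.2 (Ne.symm hx.1)⟩
      have h1 := ih (W.filter (G.Adj v)) ?_ (fun Q => φ (insert v Q)) ?_ (K.erase v) (K'.erase v)
        (hsub K hK hvK) (hsub K' hK' hvK')
      · simpa only [insert_erase hvK, insert_erase hvK'] using h1
      · intro S hS hSc F hF
        obtain ⟨z, hz, hzF, hzS⟩ := hR (insert v S)
          (insert_subset hv (hS.trans (filter_subset _ _))) ((card_insert_le _ _).trans (by omega)) F hF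
        exact ⟨z, mem_filter.2 ⟨hz, hzS v (mem_insert_self _ _)⟩, hzF, fun s hs => hzS s (mem_insert_of_mem hs)⟩
      · intro Q u w hu hw hQu hQw
        have hup : ∀ L, TC G r (W.filter (G.Adj v)) L → TC G (r + 1) W (insert v L) := by
          intro L hL
          exact TC.insert ⟨hL.1.trans (filter_subset _ _), hL.2⟩ hv (fun x hx => (mem_filter.1 (hL.1 hx)).2)
        have hne : ∀ L, TC G r (W.filter (G.Adj v)) L → v ∉ L := by
          intro L hL hvL
          exact G.loopless.irrefl _ (mem_filter.1 (hL.1 hvL)).2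
        have h2 := hφ (insert v Q) u w ?_ ?_ ?_ ?_
        · show φ (insert v (insert u Q)) = φ (insert v (insert w Q))
          rw [Finset.insert_comm v u, Finset.insert_comm v w]; exact h2
        · rw [mem_insert]; rintro (h | h)
          · exact hne _ hQu (by rw [h]; exact mem_insert_self _ _)
          · exact hu h
        · rw [mem_insert]; rintro (h | h)
          · exact hne _ hQw (by rw [h]; exact mem_insert_self _ _)
          · exact hw h
        · rw [Finset.insert_comm u v]; exact hup _ hQu
        · rw [Finset.insert_comm w v]; exact hup _ hQw
    obtain ⟨u, hu⟩ : K.Nonempty := card_pos.1 (by rw [hK.2.1]; omega)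
    obtain ⟨v, hv⟩ : K'.Nonempty := card_pos.1 (by rw [hK'.2.1]; omega)
    by_cases hr : r = 0
    · subst hr
      obtain ⟨a, rfl⟩ := card_eq_one.1 hK.2.1
      obtain ⟨b, rfl⟩ := card_eq_one.1 hK'.2.1
      exact hφ ∅ a b (by simp) (by simp) (by simpa using hK) (by simpa using hK')
    · obtain ⟨z, hz, -, hzS⟩ := hR {u, v} (insert_subset (hK.1 hu) (singleton_subset_iff.2 (hK'.1 hv)))
        (card_le_two.trans (by omega)) ∅ (by simp)
      have mk : ∀ w ∈ W, G.Adj w z → ∃ L, TC G (r + 1) W L ∧ w ∈ L ∧ z ∈ L := by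
        intro w hw hwz
        obtain ⟨Q, hQ, -, hQS⟩ := hR.ext ∅ (by simp) (r - 1) {w, z}
          (insert_subset hw (singleton_subset_iff.2 hz)) (by have := card_le_two (a := w) (b := z); omega)
        refine ⟨insert w (insert z Q), ?_, by simp, by simp⟩
        have h1 := hQ.insert hz (hQS z (by simp))
        have h2 := h1.insert hw (by
          intro x hx
          rcases mem_insert.1 hx with rfl | hx
          · exact hwz
          · exact hQS w (by simp) x hx)
        rwa [show r - 1 + 1 + 1 = r + 1 by omega] at h2
      obtain ⟨L, hL, huL, hzL⟩ := mk u (hK.1 hu) (hzS u (by simp))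
      obtain ⟨L', hL', hvL, hzL'⟩ := mk v (hK'.1 hv) (hzS v (by simp))
      rw [link u (hK.1 hu) K L hK hL hu huL, link z hz L L' hL hL' hzL hzL',
        link v (hK'.1 hv) L' K' hL' hK' hvL hv]
end ST

section LAW
open Classical

/-- weighted degree into a set -/
def dd (β : V → V → ℤ) (v : V) (Q : Finset V) : ℤ := ∑ u ∈ Q, β v u

/-- twice the weight inside a set -/
def c2 (β : V → V → ℤ) (K : Finset V) : ℤ := ∑ u ∈ K, dd β u K

/-- a 0/1 symmetric weight -/
structure Wt (β : V → V → ℤ) : Prop where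
  symm : ∀ u v, β u v = β v u
  diag : ∀ v, β v v = 0
  nonneg : ∀ u v, 0 ≤ β u v
  le_one : ∀ u v, β u v ≤ 1

variable [DecidableEq V]

lemma dd_insert {β : V → V → ℤ} {v a : V} {Q : Finset V} (ha : a ∉ Q) :
    dd β v (insert a Q) = β v a + dd β v Q := by
  unfold dd; rw [sum_insert ha]

lemma c2_insert {β : V → V → ℤ} (hβ : Wt β) {v : V} {Q : Finset V} (hv : v ∉ Q) :
    c2 β (insert v Q) = c2 β Q + 2 * dd β v Q := by
  unfold c2
  rw [sum_insert hv, dd_insert hv, hβ.diag]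
  have : ∑ u ∈ Q, dd β u (insert v Q) = ∑ u ∈ Q, (β v u + dd β u Q) :=
    sum_congr rfl (fun u _ => by rw [dd_insert hv, hβ.symm u v])
  rw [this, sum_add_distrib]
  have h2 : ∑ u ∈ Q, β v u = dd β v Q := rfl
  rw [h2]; ring

/-- no small gadgets inside `W` -/
def GFree (G : SimpleGraph V) (r : ℕ) (β : V → V → ℤ) (W : Finset V) : Prop :=
  ∀ S ⊆ W, S.card ≤ 3 * r → ∀ T1 T2, IsKrTilingOn G r T1 S → IsKrTilingOn G r T2 S →
    ∑ K ∈ T1, c2 β K = ∑ K ∈ T2, c2 β K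

lemma TC.ne_of_disj {G : SimpleGraph V} {k : ℕ} {W K K' : Finset V} (h : TC G (k + 1) W K)
    (hd : Disjoint K K') : K ≠ K' := by
  rintro rfl
  rw [disjoint_self_iff_empty] at hd
  rw [hd] at h
  simp [TC] at h

lemma three_tiling {G : SimpleGraph V} {k : ℕ} {W K1 K2 K3 : Finset V}
    (h1 : TC G (k + 1) W K1) (h2 : TC G (k + 1) W K2) (h3 : TC G (k + 1) W K3)
    (h12 : Disjoint K1 K2) (h13 : Disjoint K1 K3) (h23 : Disjoint K2 K3) (β : V → V → ℤ) :
    IsKrTilingOn G (k + 1) {K1, K2, K3} (K1 ∪ K2 ∪ K3) ∧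
      ∑ K ∈ ({K1, K2, K3} : Finset (Finset V)), c2 β K = c2 β K1 + c2 β K2 + c2 β K3 := by
  have n12 := h1.ne_of_disj h12
  have n13 := h1.ne_of_disj h13
  have n23 := h2.ne_of_disj h23
  refine ⟨⟨?_, ?_, ?_⟩, ?_⟩
  · intro K hK
    simp only [mem_insert, mem_singleton] at hK
    rcases hK with rfl | rfl | rfl
    exacts [h1.nclique, h2.nclique, h3.nclique]
  · intro K hK K' hK' hne
    simp only [mem_insert, mem_singleton] at hK hK'
    rcases hK with rfl | rfl | rfl <;> rcases hK' with rfl | rfl | rfl <;>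
      first | exact absurd rfl hne | assumption | (apply Disjoint.symm; assumption)
  · ext x; simp [or_assoc]
  · rw [sum_insert (by simp [n12, n13]), sum_insert (by simp [n23]), sum_singleton, add_assoc]

lemma two_tiling {G : SimpleGraph V} {k : ℕ} {W K1 K2 : Finset V}
    (h1 : TC G (k + 1) W K1) (h2 : TC G (k + 1) W K2)
    (h12 : Disjoint K1 K2) (β : V → V → ℤ) :
    IsKrTilingOn G (k + 1) {K1, K2} (K1 ∪ K2) ∧
      ∑ K ∈ ({K1, K2} : Finset (Finset V)), c2 β K = c2 β K1 + c2 β K2 := by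
  have n12 := h1.ne_of_disj h12
  refine ⟨⟨?_, ?_, ?_⟩, ?_⟩
  · intro K hK
    simp only [mem_insert, mem_singleton] at hK
    rcases hK with rfl | rfl
    exacts [h1.nclique, h2.nclique]
  · intro K hK K' hK' hne
    simp only [mem_insert, mem_singleton] at hK hK'
    rcases hK with rfl | rfl <;> rcases hK' with rfl | rfl <;>
      first | exact absurd rfl hne | assumption | (apply Disjoint.symm; assumption)
  · ext x; simp
  · rw [sum_insert (by simp [n12]), sum_singleton]

lemma swap_disj {G : SimpleGraph V} {k : ℕ} {W : Finset V} {β : V → V → ℤ} (hβ : Wt β)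
    (hG : GFree G (k + 1) β W) {u v : V} (hu : u ∈ W) (hv : v ∈ W) (huv : u ≠ v) {Q Q' : Finset V}
    (hQ : TC G k W Q) (hQ' : TC G k W Q') (hd : Disjoint Q Q')
    (h1 : ∀ x ∈ Q, G.Adj u x ∧ G.Adj v x) (h2 : ∀ x ∈ Q', G.Adj u x ∧ G.Adj v x) :
    dd β u Q - dd β v Q = dd β u Q' - dd β v Q' := by
  have uQ : u ∉ Q := fun h => G.loopless.irrefl _ (h1 u h).1
  have vQ : v ∉ Q := fun h => G.loopless.irrefl _ (h1 v h).2
  have uQ' : u ∉ Q' := fun h => G.loopless.irrefl _ (h2 u h).1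
  have vQ' : v ∉ Q' := fun h => G.loopless.irrefl _ (h2 v h).2
  have a1 := hQ.insert hu (fun x hx => (h1 x hx).1)
  have a2 := hQ'.insert hv (fun x hx => (h2 x hx).2)
  have b1 := hQ.insert hv (fun x hx => (h1 x hx).2)
  have b2 := hQ'.insert hu (fun x hx => (h2 x hx).1)
  obtain ⟨t1, s1⟩ := two_tiling a1 a2 (by
    simp only [disjoint_insert_left, disjoint_insert_right, mem_insert]; tauto) β
  obtain ⟨t2, s2⟩ := two_tiling b1 b2 (by
    simp only [disjoint_insert_left, disjoint_insert_right, mem_insert]; tauto) β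
  have hS : insert v Q ∪ insert u Q' = insert u Q ∪ insert v Q' := by
    ext x; simp only [mem_union, mem_insert]; tauto
  rw [hS] at t2
  have := hG _ (union_subset a1.1 a2.1) ((card_union_le _ _).trans (by rw [a1.2.1, a2.2.1]; omega)) _ _ t1 t2
  rw [s1, s2, c2_insert hβ uQ, c2_insert hβ vQ, c2_insert hβ uQ', c2_insert hβ vQ'] at this
  linarith

lemma swap_gen {G : SimpleGraph V} {k C : ℕ} {W : Finset V} {β : V → V → ℤ} (hβ : Wt β)
    (hG : GFree G (k + 1) β W) (hR : Rob G (k + 1) C W) (hC : 5 * (k + 1) ≤ C)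
    {u v : V} (hu : u ∈ W) (hv : v ∈ W) {Q Q' : Finset V}
    (hQ : TC G k W Q) (hQ' : TC G k W Q')
    (h1 : ∀ x ∈ Q, G.Adj u x ∧ G.Adj v x) (h2 : ∀ x ∈ Q', G.Adj u x ∧ G.Adj v x) :
    dd β u Q - dd β v Q = dd β u Q' - dd β v Q' := by
  by_cases huv : u = v
  · subst huv; simp
  obtain ⟨R, hR1, hR2, hR3⟩ := hR.ext (Q ∪ Q') ((card_union_le _ _).trans (by rw [hQ.2.1, hQ'.2.1]; omega))
    k {u, v} (insert_subset hu (singleton_subset_iff.2 hv)) (by have := card_le_two (a := u) (b := v); omega)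
  rw [disjoint_union_right] at hR2
  have h3 : ∀ x ∈ R, G.Adj u x ∧ G.Adj v x := fun x hx => ⟨hR3 u (by simp) x hx, hR3 v (by simp) x hx⟩
  rw [swap_disj hβ hG hu hv huv hQ hR1 hR2.1.symm h1 h3, swap_disj hβ hG hu hv huv hQ' hR1 hR2.2.symm h2 h3]

lemma add_law {G : SimpleGraph V} {k C : ℕ} {W : Finset V} {β : V → V → ℤ} (hβ : Wt β)
    (hG : GFree G (k + 1) β W) (hR : Rob G (k + 1) C W) (hC : 5 * (k + 1) ≤ C)
    {u v w : V} (hu : u ∈ W) (hv : v ∈ W) (hw : w ∈ W) {P Q R : Finset V}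
    (hP : TC G k W P) (hQ : TC G k W Q) (hR' : TC G k W R)
    (h1 : ∀ x ∈ P, G.Adj u x ∧ G.Adj v x) (h2 : ∀ x ∈ Q, G.Adj v x ∧ G.Adj w x)
    (h3 : ∀ x ∈ R, G.Adj u x ∧ G.Adj w x) :
    (dd β u P - dd β v P) + (dd β v Q - dd β w Q) = dd β u R - dd β w R := by
  by_cases huv : u = v
  · subst huv
    rw [sub_self, zero_add]
    exact swap_gen hβ hG hR hC hu hw hQ hR' h2 h3
  by_cases hvw : v = w
  · subst hvw
    rw [sub_self, add_zero]
    exact swap_gen hβ hG hR hC hu hv hP hR' h1 h3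
  by_cases huw : u = w
  · subst huw
    have := swap_gen hβ hG hR hC hu hv hP hQ h1 (fun x hx => (h2 x hx).symm)
    linarith
  have c3 : ({u, v, w} : Finset V).card ≤ 3 := card_le_three
  have mk : ∀ F : Finset V, F.card ≤ 2 * k → ∀ a b, a ∈ W → b ∈ W → ∃ Q, TC G k W Q ∧ Disjoint Q F ∧
      Disjoint Q {u, v, w} ∧ ∀ x ∈ Q, G.Adj a x ∧ G.Adj b x := by
    intro F hF a b ha hb
    obtain ⟨Q, q1, q2, q3⟩ := hR.ext (F ∪ {u, v, w}) ((card_union_le _ _).trans (by omega)) k {a, b}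
      (insert_subset ha (singleton_subset_iff.2 hb)) (by have := card_le_two (a := a) (b := b); omega)
    rw [disjoint_union_right] at q2
    exact ⟨Q, q1, q2.1, q2.2, fun x hx => ⟨q3 a (by simp) x hx, q3 b (by simp) x hx⟩⟩
  obtain ⟨P', p1, -, p3, p4⟩ := mk ∅ (by simp) u v hu hv
  obtain ⟨Q', q1, q2, q3, q4⟩ := mk P' (by rw [p1.2.1]; omega) v w hv hw
  obtain ⟨R', r1, r2, r3, r4⟩ := mk (P' ∪ Q') ((card_union_le _ _).trans (by rw [p1.2.1, q1.2.1]; omega)) u w hu hw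
  rw [disjoint_union_right] at r2
  rw [swap_gen hβ hG hR hC hu hv hP p1 h1 p4, swap_gen hβ hG hR hC hv hw hQ q1 h2 q4,
    swap_gen hβ hG hR hC hu hw hR' r1 h3 r4]
  simp only [disjoint_insert_right, disjoint_singleton_right] at p3 q3 r3
  have a1 := p1.insert hu (fun x hx => (p4 x hx).1)
  have a2 := q1.insert hv (fun x hx => (q4 x hx).1)
  have a3 := r1.insert hw (fun x hx => (r4 x hx).2)
  have b1 := p1.insert hv (fun x hx => (p4 x hx).2)
  have b2 := q1.insert hw (fun x hx => (q4 x hx).2)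
  have b3 := r1.insert hu (fun x hx => (r4 x hx).1)
  have q2' := q2.symm
  have r21 := r2.1.symm
  have r22 := r2.2.symm
  obtain ⟨t1, s1⟩ := three_tiling a1 a2 a3
    (by simp only [disjoint_insert_left, disjoint_insert_right, mem_insert]; tauto)
    (by simp only [disjoint_insert_left, disjoint_insert_right, mem_insert]; tauto)
    (by simp only [disjoint_insert_left, disjoint_insert_right, mem_insert]; tauto) β
  obtain ⟨t2, s2⟩ := three_tiling b1 b2 b3
    (by simp only [disjoint_insert_left, disjoint_insert_right, mem_insert]; tauto)
    (by simp only [disjoint_insert_left, disjoint_insert_right, mem_insert]; tauto)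
    (by simp only [disjoint_insert_left, disjoint_insert_right, mem_insert]; tauto) β
  have hS : insert v P' ∪ insert w Q' ∪ insert u R' = insert u P' ∪ insert v Q' ∪ insert w R' := by
    ext x; simp only [mem_union, mem_insert]; tauto
  rw [hS] at t2
  have := hG _ (union_subset (union_subset a1.1 a2.1) a3.1)
    ((card_union_le _ _).trans (by
      have := card_union_le (insert u P') (insert v Q')
      rw [a1.2.1, a2.2.1] at this
      rw [a3.2.1]; omega)) _ _ t1 t2
  rw [s1, s2, c2_insert hβ p3.1, c2_insert hβ q3.2.1, c2_insert hβ r3.2.2, c2_insert hβ p3.2.1,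
    c2_insert hβ q3.2.2, c2_insert hβ r3.1] at this
  linarith

/-- existence of a potential -/
lemma exists_pot {G : SimpleGraph V} {k C : ℕ} {W : Finset V} {β : V → V → ℤ} (hβ : Wt β)
    (hG : GFree G (k + 1) β W) (hR : Rob G (k + 1) C W) (hC : 5 * (k + 1) ≤ C) :
    ∃ y : V → ℤ, (∀ u ∈ W, ∀ v ∈ W, ∀ Q, TC G k W Q → (∀ x ∈ Q, G.Adj u x ∧ G.Adj v x) →
        dd β u Q - dd β v Q = y u - y v) ∧
      ∀ K K', TC G (k + 1) W K → TC G (k + 1) W K' →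
        c2 β K - 2 * ∑ x ∈ K, y x = c2 β K' - 2 * ∑ x ∈ K', y x := by
  by_cases hW : W = ∅
  · subst hW
    refine ⟨fun _ => 0, by simp, ?_⟩
    intro K K' hK
    have := subset_empty.1 hK.1
    subst this
    simp [TC] at hK
  obtain ⟨v0, hv0⟩ := nonempty_iff_ne_empty.2 hW
  have hex : ∀ u ∈ W, ∃ Q, TC G k W Q ∧ ∀ x ∈ Q, G.Adj u x ∧ G.Adj v0 x := by
    intro u hu
    obtain ⟨Q, q1, -, q3⟩ := hR.ext ∅ (by simp) k {u, v0}
      (insert_subset hu (singleton_subset_iff.2 hv0)) (by have := card_le_two (a := u) (b := v0); omega)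
    exact ⟨Q, q1, fun x hx => ⟨q3 u (by simp) x hx, q3 v0 (by simp) x hx⟩⟩
  choose! F hF1 hF2 using hex
  have key : ∀ u ∈ W, ∀ v ∈ W, ∀ Q, TC G k W Q → (∀ x ∈ Q, G.Adj u x ∧ G.Adj v x) →
        dd β u Q - dd β v Q = (dd β u (F u) - dd β v0 (F u)) - (dd β v (F v) - dd β v0 (F v)) := by
    intro u hu v hv Q hQ hQa
    have := add_law hβ hG hR hC hu hv hv0 hQ (hF1 v hv) (hF1 u hu) hQa (hF2 v hv) (hF2 u hu)
    linarith
  refine ⟨fun u => dd β u (F u) - dd β v0 (F u), key, ?_⟩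
  apply tight_conn (k + 1) W (fun S hS hc F hF => hR S hS hc F (by omega))
    (fun K => c2 β K - 2 * ∑ x ∈ K, (dd β x (F x) - dd β v0 (F x)))
  intro Q u v hu hv hQu hQv
  have hQ : TC G k W Q := hQu.sub (subset_insert _ _) (by
    have := hQu.2.1
    rw [card_insert_of_notMem hu] at this; omega)
  have h1 := key u (hQu.1 (mem_insert_self _ _)) v (hQv.1 (mem_insert_self _ _)) Q hQ (by
    intro x hx
    exact ⟨hQu.2.2 u (mem_insert_self _ _) x (mem_insert_of_mem hx) (by rintro rfl; exact hu hx),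
      hQv.2.2 v (mem_insert_self _ _) x (mem_insert_of_mem hx) (by rintro rfl; exact hv hx)⟩)
  simp only [c2_insert hβ hu, c2_insert hβ hv, sum_insert hu, sum_insert hv]
  linarith
end LAW

section ST8
open Classical
variable [DecidableEq V]

lemma dd_nonneg {β : V → V → ℤ} (hβ : Wt β) (v : V) (Q : Finset V) : 0 ≤ dd β v Q :=
  sum_nonneg (fun u _ => hβ.nonneg v u)

lemma dd_le_card {β : V → V → ℤ} (hβ : Wt β) (v : V) (Q : Finset V) : dd β v Q ≤ Q.card := by
  have := sum_le_card_nsmul Q (fun u => β v u) 1 (fun u _ => hβ.le_one v u)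
  simpa [dd] using this

lemma c2_nonneg {β : V → V → ℤ} (hβ : Wt β) (Q : Finset V) : 0 ≤ c2 β Q :=
  sum_nonneg (fun u _ => dd_nonneg hβ u Q)

lemma c2_eq_zero {β : V → V → ℤ} (hβ : Wt β) {Q : Finset V} (h : c2 β Q = 0) :
    ∀ u ∈ Q, ∀ x ∈ Q, β u x = 0 := by
  intro u hu x hx
  have h1 := (sum_eq_zero_iff_of_nonneg (fun u _ => dd_nonneg hβ u Q)).1 h u hu
  exact (sum_eq_zero_iff_of_nonneg (fun x _ => hβ.nonneg u x)).1 h1 x hx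

lemma c2_zero {β : V → V → ℤ} {Q : Finset V} (h : ∀ u ∈ Q, ∀ x ∈ Q, β u x = 0) : c2 β Q = 0 :=
  sum_eq_zero (fun u hu => sum_eq_zero (fun x hx => h u hu x hx))

lemma c2_erase {β : V → V → ℤ} (hβ : Wt β) {A : Finset V} {v : V} (hv : v ∈ A) :
    c2 β A = c2 β (A.erase v) + 2 * dd β v A := by
  have h1 := c2_insert hβ (notMem_erase v A)
  have h2 : dd β v A = dd β v (A.erase v) := by
    have := dd_insert (β := β) (v := v) (notMem_erase v A)
    rw [insert_erase hv, hβ.diag, zero_add] at this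
    exact this
  rw [insert_erase hv] at h1
  rw [h1, h2]

lemma L_M {G : SimpleGraph V} {k C : ℕ} {W : Finset V} {β : V → V → ℤ} (hβ : Wt β)
    (hG : GFree G (k + 1) β W) (hR : Rob G (k + 1) C W) (hC : 5 * (k + 1) ≤ C) (hk : 1 ≤ k)
    {M : Finset V} (hM : TC G (k + 3) W M) {u w a b : V} (hu : u ∈ M) (hw : w ∈ M) (ha : a ∈ M) (hb : b ∈ M)
    (huw : u ≠ w) (hua : u ≠ a) (hub : u ≠ b) (hwa : w ≠ a) (hwb : w ≠ b) (hab : a ≠ b) :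
    β u a - β w a = β u b - β w b := by
  set S := M \ {u, w, a, b} with hS
  have hc : S.card = k - 1 := by
    rw [hS, card_sdiff_of_subset, hM.2.1]
    · rw [card_insert_of_notMem (by simp [*]), card_insert_of_notMem (by simp [*]), card_pair hab]
      omega
    · intro x hx
      simp only [mem_insert, mem_singleton] at hx
      rcases hx with rfl | rfl | rfl | rfl <;> assumption
  have hSm : ∀ x ∈ S, x ∈ M ∧ x ≠ u ∧ x ≠ w ∧ x ≠ a ∧ x ≠ b := by
    intro x hx
    rw [hS] at hx
    simp only [mem_sdiff, mem_insert, mem_singleton, not_or] at hx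
    exact hx
  have mk : ∀ c ∈ M, c ≠ u → c ≠ w → c ∉ S → TC G k W (insert c S) ∧
      ∀ x ∈ insert c S, G.Adj u x ∧ G.Adj w x := by
    intro c hc' hcu hcw hcS
    refine ⟨hM.sub ?_ ?_, ?_⟩
    · intro x hx
      rcases mem_insert.1 hx with rfl | hx
      · exact hc'
      · exact (hSm x hx).1
    · rw [card_insert_of_notMem hcS, hc]; omega
    · intro x hx
      rcases mem_insert.1 hx with rfl | hx
      · exact ⟨hM.2.2 u hu x hc' hcu.symm, hM.2.2 w hw x hc' hcw.symm⟩
      · have := hSm x hx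
        exact ⟨hM.2.2 u hu x this.1 this.2.1.symm, hM.2.2 w hw x this.1 this.2.2.1.symm⟩
  have haS : a ∉ S := fun h => (hSm a h).2.2.2.1 rfl
  have hbS : b ∉ S := fun h => (hSm b h).2.2.2.2 rfl
  obtain ⟨a1, a2⟩ := mk a ha hua.symm hwa.symm haS
  obtain ⟨b1, b2⟩ := mk b hb hub.symm hwb.symm hbS
  have := swap_gen hβ hG hR hC (hM.1 hu) (hM.1 hw) a1 b1 a2 b2
  rw [dd_insert haS, dd_insert haS, dd_insert hbS, dd_insert hbS] at this
  linarith

/-- the linear law -/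
def Law (G : SimpleGraph V) (k : ℕ) (W : Finset V) (β : V → V → ℤ) (y : V → ℤ) : Prop :=
  ∀ K, TC G (k + 1) W K → 2 * ∑ x ∈ K, y x = c2 β K

lemma lemma_Y {G : SimpleGraph V} {k C : ℕ} {W : Finset V} {β : V → V → ℤ} (hβ : Wt β)
    (hG : GFree G (k + 1) β W) (hR : Rob G (k + 1) C W) (hC : 5 * (k + 1) ≤ C) (hk : 1 ≤ k)
    {Q : Finset V} (hQ : TC G (k + 1) W Q) (hQ0 : ∀ u ∈ Q, ∀ x ∈ Q, β u x = 0) {v : V} (hv : v ∈ W)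
    (hvQ : ∀ x ∈ Q, G.Adj v x) (c : ℤ) (hc : ∀ x ∈ Q, β v x = c) :
    ∃ y, Law G k W β y ∧ ∀ x ∈ Q, y x = 0 := by
  obtain ⟨y, hy1, hy2⟩ := exists_pot hβ hG hR hC
  have hconst : ∀ u ∈ Q, ∀ w ∈ Q, y u = y w := by
    intro u hu w hw
    by_cases huw : u = w
    · rw [huw]
    set S := (Q.erase u).erase w with hS
    have hSm : ∀ x ∈ S, x ∈ Q ∧ x ≠ u ∧ x ≠ w := by
      intro x hx
      simp only [hS, mem_erase] at hx
      exact ⟨hx.2.2, hx.2.1, hx.1⟩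
    have hvQ' : v ∉ Q := fun h => G.loopless.irrefl _ (hvQ v h)
    have hvS : v ∉ S := fun h => hvQ' (hSm v h).1
    have hSc : S.card = k - 1 := by
      rw [hS, card_erase_of_mem (mem_erase.2 ⟨Ne.symm huw, hw⟩), card_erase_of_mem hu, hQ.2.1]
      omega
    have hST : TC G (k - 1) W S := hQ.sub (fun x hx => (hSm x hx).1) hSc
    have hI := hST.insert hv (fun x hx => hvQ x (hSm x hx).1)
    rw [Nat.sub_add_cancel hk] at hI
    have h1 := hy1 u (hQ.1 hu) w (hQ.1 hw) _ hI (by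
      intro x hx
      rcases mem_insert.1 hx with rfl | hx
      · exact ⟨(hvQ u hu).symm, (hvQ w hw).symm⟩
      · have := hSm x hx
        exact ⟨hQ.2.2 u hu x this.1 this.2.1.symm, hQ.2.2 w hw x this.1 this.2.2.symm⟩)
    rw [dd_insert hvS, dd_insert hvS, hβ.symm u v, hβ.symm w v, hc u hu, hc w hw] at h1
    have z1 : dd β u S = 0 := sum_eq_zero (fun x hx => hQ0 u hu x (hSm x hx).1)
    have z2 : dd β w S = 0 := sum_eq_zero (fun x hx => hQ0 w hw x (hSm x hx).1)
    rw [z1, z2] at h1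
    linarith
  obtain ⟨u0, hu0⟩ : Q.Nonempty := card_pos.1 (by rw [hQ.2.1]; omega)
  refine ⟨fun x => y x - y u0, ?_, fun x hx => by show y x - y u0 = 0; rw [hconst x hx u0 hu0, sub_self]⟩
  intro K hK
  have h1 := hy2 K Q hK hQ
  have h2 : ∑ x ∈ Q, y x = Q.card * y u0 := by
    rw [sum_congr rfl (fun x hx => hconst x hx u0 hu0), sum_const, nsmul_eq_mul]
  rw [c2_zero hQ0, h2, hQ.2.1] at h1
  rw [sum_sub_distrib, sum_const, nsmul_eq_mul, hK.2.1]
  linarith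

lemma law_K1 {G : SimpleGraph V} {k : ℕ} {W : Finset V} {β : V → V → ℤ} (hβ : Wt β) {y : V → ℤ}
    (hL : Law G k W β y) {A : Finset V} (hA : TC G (k + 2) W A) :
    ∃ κ : ℤ, (∀ v ∈ A, y v = dd β v A - κ) ∧ c2 β A = 2 * (k + 1) * κ := by
  have h1 : ∀ v ∈ A, 2 * ∑ x ∈ A, y x - 2 * y v = c2 β A - 2 * dd β v A := by
    intro v hv
    have h2 := hL (A.erase v) (hA.sub (erase_subset _ _) (by rw [card_erase_of_mem hv, hA.2.1]; rfl))
    have h3 := c2_erase hβ hv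
    have h4 := add_sum_erase A y hv
    linarith
  obtain ⟨v0, hv0⟩ : A.Nonempty := card_pos.1 (by rw [hA.2.1]; omega)
  have h2 : ∀ v ∈ A, y v = dd β v A - (dd β v0 A - y v0) := by
    intro v hv
    have := h1 v hv
    have := h1 v0 hv0
    linarith
  refine ⟨dd β v0 A - y v0, h2, ?_⟩
  have h3 : ∑ x ∈ A, y x = c2 β A - (k + 2) * (dd β v0 A - y v0) := by
    rw [sum_congr rfl h2, sum_sub_distrib, sum_const, nsmul_eq_mul, hA.2.1]
    push_cast
    rfl
  have h4 := h1 v0 hv0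
  rw [h3] at h4
  linarith

lemma zero_clique_law {G : SimpleGraph V} {k C : ℕ} {W : Finset V} {β : V → V → ℤ} (hβ : Wt β)
    (hG : GFree G (k + 1) β W) (hR : Rob G (k + 1) C W) (hC : 5 * (k + 1) ≤ C) (hk : 1 ≤ k)
    {A : Finset V} (hA : TC G (k + 2) W A) (hA0 : ∀ u ∈ A, ∀ x ∈ A, β u x = 0) :
    ∃ y, Law G k W β y ∧ ∀ x ∈ A, y x = 0 := by
  obtain ⟨v, hv⟩ : A.Nonempty := card_pos.1 (by rw [hA.2.1]; omega)
  have hQ : TC G (k + 1) W (A.erase v) :=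
    hA.sub (erase_subset _ _) (by rw [card_erase_of_mem hv, hA.2.1]; rfl)
  obtain ⟨y, hL, hy⟩ := lemma_Y hβ hG hR hC hk hQ
    (fun u hu x hx => hA0 u (mem_of_mem_erase hu) x (mem_of_mem_erase hx)) (hA.1 hv)
    (fun x hx => hA.2.2 v hv x (mem_of_mem_erase hx) (mem_erase.1 hx).1.symm) 0
    (fun x hx => hA0 v hv x (mem_of_mem_erase hx))
  refine ⟨y, hL, ?_⟩
  obtain ⟨κ, h1, h2⟩ := law_K1 hβ hL hA
  rw [c2_zero hA0] at h2
  have hκ : κ = 0 := by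
    have : (2 * ((k : ℤ) + 1)) ≠ 0 := by positivity
    rcases mul_eq_zero.1 h2.symm with h | h
    · exact absurd h this
    · exact h
  intro x hx
  rw [h1 x hx, hκ, sub_zero]
  exact sum_eq_zero (fun u hu => hA0 x hx u hu)

lemma exists_clique_through {G : SimpleGraph V} {k C : ℕ} {W : Finset V} (hR : Rob G (k + 1) C W)
    {u v : V} (hu : u ∈ W) (hv : v ∈ W) (huv : G.Adj u v) : ∃ A, TC G (k + 2) W A ∧ u ∈ A ∧ v ∈ A := by
  obtain ⟨Q, q1, -, q3⟩ := hR.ext ∅ (by simp) k {u, v} (insert_subset hu (singleton_subset_iff.2 hv))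
    (by have := card_le_two (a := u) (b := v); omega)
  refine ⟨insert u (insert v Q), (q1.insert hv (q3 v (by simp))).insert hu ?_, by simp, by simp⟩
  intro x hx
  rcases mem_insert.1 hx with rfl | hx
  · exact huv
  · exact q3 u (by simp) x hx

lemma exists_clique_at {G : SimpleGraph V} {k C : ℕ} {W : Finset V} (hR : Rob G (k + 1) C W)
    {u : V} (hu : u ∈ W) : ∃ A, TC G (k + 2) W A ∧ u ∈ A := by
  obtain ⟨z, hz, -, hzu⟩ := hR {u} (singleton_subset_iff.2 hu) (by simp) ∅ (by simp)
  obtain ⟨A, h1, h2, -⟩ := exists_clique_through hR hu hz (hzu u (by simp))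
  exact ⟨A, h1, h2⟩

lemma dd_le_of_mem {β : V → V → ℤ} (hβ : Wt β) {A : Finset V} {v : V} {k : ℕ} (hA : A.card = k + 2) (hv : v ∈ A) :
    dd β v A ≤ k + 1 := by
  have h1 := dd_insert (β := β) (v := v) (notMem_erase v A)
  rw [insert_erase hv, hβ.diag, zero_add] at h1
  have h2 := dd_le_card hβ v (A.erase v)
  rw [card_erase_of_mem hv, hA] at h2
  push_cast at h2
  rw [h1]
  have : ((k + 2 - 1 : ℕ) : ℤ) = k + 1 := by omega
  linarith

lemma law_le {G : SimpleGraph V} {k C : ℕ} {W : Finset V} {β : V → V → ℤ} (hβ : Wt β) {y : V → ℤ}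
    (hR : Rob G (k + 1) C W) (hL : Law G k W β y) {v : V} (hv : v ∈ W) : y v ≤ k := by
  obtain ⟨A, hA, hvA⟩ := exists_clique_at hR hv
  obtain ⟨κ, h1, h2⟩ := law_K1 hβ hL hA
  have h3 := dd_le_of_mem hβ hA.2.1 hvA
  have h4 := c2_nonneg hβ A
  rw [h1 v hvA]
  by_cases hκ : 1 ≤ κ
  · linarith
  have hκ0 : κ = 0 := by
    have : 0 ≤ κ := by
      by_contra hneg
      have : 2 * ((k : ℤ) + 1) * κ < 0 := mul_neg_of_pos_of_neg (by positivity) (by linarith)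
      linarith
    omega
  rw [hκ0, mul_zero] at h2
  have : dd β v A = 0 := sum_eq_zero (fun u hu => c2_eq_zero hβ h2 v hvA u hu)
  rw [this, hκ0]
  simp

lemma law_star {G : SimpleGraph V} {k : ℕ} {W : Finset V} {β : V → V → ℤ} (hβ : Wt β) {y : V → ℤ}
    (hL : Law G k W β y) (hk : 1 ≤ k) {v : V} (hyv : y v = k) {A : Finset V}
    (hA : TC G (k + 2) W A) (hvA : v ∈ A) :
    (∀ x ∈ A.erase v, β v x = 1) ∧ (∀ u ∈ A.erase v, ∀ x ∈ A.erase v, β u x = 0) ∧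
      ∀ u ∈ A, u ≠ v → y u = 0 := by
  obtain ⟨κ, h1, h2⟩ := law_K1 hβ hL hA
  have h3 := dd_le_of_mem hβ hA.2.1 hvA
  have h4 := c2_nonneg hβ (A.erase v)
  have h5 := c2_erase hβ hvA
  have h6 := h1 v hvA
  have hk' : (1 : ℤ) ≤ k := by exact_mod_cast hk
  have hκ : κ = 1 := by
    have hle : κ ≤ 1 := by linarith
    by_contra hne
    have hle0 : κ ≤ 0 := by omega
    have h7 : c2 β A ≤ 0 := by rw [h2]; exact mul_nonpos_of_nonneg_of_nonpos (by positivity) hle0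
    have h8 := dd_nonneg hβ v A
    have h9 : dd β v A = 0 := by linarith
    have h10 : κ = -k := by linarith
    rw [h10] at h2
    nlinarith
  subst hκ
  have hdd : dd β v A = k + 1 := by linarith
  have hz : c2 β (A.erase v) = 0 := by linarith
  have hz' := c2_eq_zero hβ hz
  have hone : ∀ x ∈ A.erase v, β v x = 1 := by
    have e1 := dd_insert (β := β) (v := v) (notMem_erase v A)
    rw [insert_erase hvA, hβ.diag, zero_add] at e1
    have e2 : ∑ x ∈ A.erase v, (1 - β v x) = 0 := by
      rw [sum_sub_distrib, sum_const, card_erase_of_mem hvA, hA.2.1]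
      have : ∑ x ∈ A.erase v, β v x = k + 1 := by rw [← hdd, e1]; rfl
      rw [this]; simp
    have e3 := (sum_eq_zero_iff_of_nonneg (fun x _ => sub_nonneg.2 (hβ.le_one v x))).1 e2
    intro x hx
    have := e3 x hx
    linarith
  refine ⟨hone, hz', ?_⟩
  intro u hu huv
  have e1 := dd_insert (β := β) (v := u) (notMem_erase v A)
  rw [insert_erase hvA, hβ.symm u v, hone u (mem_erase.2 ⟨huv, hu⟩)] at e1
  have e2 : dd β u (A.erase v) = 0 := sum_eq_zero (fun x hx => hz' u (mem_erase.2 ⟨huv, hu⟩) x hx)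
  rw [h1 u hu, e1, e2]; ring

lemma law_F3 {G : SimpleGraph V} {k C : ℕ} {W : Finset V} {β : V → V → ℤ} (hβ : Wt β) {y : V → ℤ}
    (hR : Rob G (k + 1) C W) (hL : Law G k W β y) {Q : Finset V} (hQ : TC G (k + 1) W Q)
    (hQ0 : ∀ x ∈ Q, y x = 0) {v : V} (hv : v ∈ W) (hvQ : ∀ x ∈ Q, G.Adj v x) : y v = 0 ∨ y v = k := by
  have hvQ' : v ∉ Q := fun h => G.loopless.irrefl _ (hvQ v h)
  obtain ⟨κ, h1, h2⟩ := law_K1 hβ hL (hQ.insert hv hvQ)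
  have h3 := hL Q hQ
  rw [sum_eq_zero hQ0, mul_zero] at h3
  rw [c2_insert hβ hvQ', ← h3, zero_add] at h2
  have h4 : dd β v Q = (k + 1) * κ := by linarith
  have h5 := dd_le_card hβ v Q
  have h6 := dd_nonneg hβ v Q
  rw [hQ.2.1] at h5
  push_cast at h5
  have h7 := h1 v (mem_insert_self _ _)
  rw [dd_insert hvQ', hβ.diag, h4] at h7
  have hp : (0 : ℤ) < k + 1 := by positivity
  have k0 : 0 ≤ κ := by
    by_contra hneg
    have : ((k : ℤ) + 1) * κ < 0 := mul_neg_of_pos_of_neg hp (by linarith)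
    linarith
  have k1 : κ ≤ 1 := by
    by_contra hgt
    have : ((k : ℤ) + 1) * 2 ≤ (k + 1) * κ := mul_le_mul_of_nonneg_left (by omega) hp.le
    linarith
  have : κ = 0 ∨ κ = 1 := by omega
  rcases this with rfl | rfl
  · left; rw [h7]; ring
  · right; rw [h7]; ring

lemma law_Z1 {G : SimpleGraph V} {k C h : ℕ} {W : Finset V} {β : V → V → ℤ} (hβ : Wt β) {y : V → ℤ}
    (hR : Rob G (k + 1) C W) (hL : Law G k W β y) (hk : 1 ≤ k)
    (hh : ∀ v ∈ W, (W.filter (fun u => ¬ G.Adj v u)).card ≤ h) {v : V} (hv : v ∈ W) (hyv : y v = k) :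
    ∑ x ∈ W, y x ≤ k * h := by
  have h1 : ∀ x ∈ W, y x ≤ if ¬ G.Adj v x then (k : ℤ) else 0 := by
    intro x hx
    by_cases hvx : G.Adj v x
    · obtain ⟨A, hA, hvA, hxA⟩ := exists_clique_through hR hv hx hvx
      have := (law_star hβ hL hk hyv hA hvA).2.2 x hxA hvx.ne'
      simp [hvx, this]
    · simp only [hvx, not_false_eq_true, if_true]
      exact law_le hβ hR hL hx
  have h2 := sum_le_sum h1
  rw [← sum_filter, sum_const, nsmul_eq_mul] at h2
  have h3 : ((W.filter (fun u => ¬ G.Adj v u)).card : ℤ) ≤ h := by exact_mod_cast hh v hv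
  have h4 : ((W.filter (fun u => ¬ G.Adj v u)).card : ℤ) * k ≤ h * k :=
    mul_le_mul_of_nonneg_right h3 (by positivity)
  linarith

lemma law_Z2 {G : SimpleGraph V} {k C h : ℕ} {W : Finset V} {β : V → V → ℤ} (hβ : Wt β) {y : V → ℤ}
    (hR : Rob G (k + 1) C W) (hL : Law G k W β y) (hk : 1 ≤ k)
    (hh : ∀ v ∈ W, (W.filter (fun u => ¬ G.Adj v u)).card ≤ h) (hW : (k + 1) * h ≤ W.card)
    {A : Finset V} (hA : TC G (k + 2) W A) (hA0 : ∀ x ∈ A, y x = 0) (hno : ∀ v ∈ W, y v ≠ k) :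
    ∑ x ∈ W, y x ≤ (k - 1) * h := by
  obtain ⟨P, hP⟩ : ∃ P : Finset V → Prop, ∀ M, P M ↔
      ((∀ x ∈ M, y x = 0) ∧ ∀ x ∈ M, ∀ x' ∈ M, x ≠ x' → G.Adj x x') := ⟨_, fun _ => Iff.rfl⟩
  obtain ⟨M, hM, hmax⟩ := exists_max_image (W.powerset.filter P) card
    ⟨A, mem_filter.2 ⟨mem_powerset.2 hA.1, (hP A).2 ⟨hA0, hA.2.2⟩⟩⟩
  have hAM := hmax A (mem_filter.2 ⟨mem_powerset.2 hA.1, (hP A).2 ⟨hA0, hA.2.2⟩⟩)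
  rw [hA.2.1] at hAM
  rw [mem_filter, mem_powerset, hP] at hM
  obtain ⟨hMW, hM0, hMa⟩ := hM
  have hMT : TC G M.card W M := ⟨hMW, rfl, hMa⟩
  -- a vertex adjacent to at least k+1 vertices of M has y = 0
  have hF : ∀ v ∈ W, k + 1 ≤ (M.filter (G.Adj v)).card → y v = 0 := by
    intro v hv hc
    obtain ⟨Q, hQ, hQc⟩ := exists_subset_card_eq hc
    have hQM : Q ⊆ M := hQ.trans (filter_subset _ _)
    rcases law_F3 hβ hR hL (hMT.sub hQM hQc) (fun x hx => hM0 x (hQM hx)) hv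
      (fun x hx => (mem_filter.1 (hQ hx)).2) with h0 | h0
    · exact h0
    · exact absurd h0 (hno v hv)
  have hcard : ∀ v, (M.filter (G.Adj v)).card + (M.filter (fun u => ¬ G.Adj v u)).card = M.card :=
    fun v => card_filter_add_card_filter_not _
  have hmiss : ∀ v ∈ W, 1 + (if 0 < y v then M.card - (k + 1) else 0) ≤ (M.filter (fun u => ¬ G.Adj v u)).card := by
    intro v hv
    have h1 := hcard v
    by_cases hyv : 0 < y v
    · simp only [hyv, if_true]
      by_contra hlt
      have := hF v hv (by omega)
      omega
    · simp only [hyv, if_false]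
      by_contra hlt
      have h0 : (M.filter (fun u => ¬ G.Adj v u)).card = 0 := by omega
      rw [card_eq_zero, filter_eq_empty_iff] at h0
      have hall : ∀ x ∈ M, G.Adj v x := fun x hx => not_not.1 (h0 hx)
      have hvM : v ∉ M := fun hm => G.loopless.irrefl _ (hall v hm)
      have hy0 := hF v hv (by rw [filter_true_of_mem hall]; omega)
      have h2 := (hMT.insert hv hall)
      have := hmax (insert v M) (mem_filter.2 ⟨mem_powerset.2 h2.1, (hP _).2 ⟨?_, h2.2.2⟩⟩)
      · rw [card_insert_of_notMem hvM] at this; omega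
      · intro x hx
        rcases mem_insert.1 hx with rfl | hx
        · exact hy0
        · exact hM0 x hx
  have hsum := sum_le_sum hmiss
  have hdc : ∑ v ∈ W, (M.filter (fun u => ¬ G.Adj v u)).card = ∑ a ∈ M, (W.filter (fun u => ¬ G.Adj a u)).card := by
    simp only [card_filter]
    rw [sum_comm]
    simp only [G.adj_comm]
  have hub : ∑ a ∈ M, (W.filter (fun u => ¬ G.Adj a u)).card ≤ M.card * h := by
    have := sum_le_card_nsmul M _ h (fun a ha => hh a (hMW ha))
    simpa using this
  rw [hdc, sum_add_distrib, ← sum_filter, sum_const, sum_const, smul_eq_mul, smul_eq_mul, mul_one] at hsum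
  have hf : (W.filter (fun v => 0 < y v)).card ≤ h := by
    obtain ⟨j, hj⟩ : ∃ j, M.card = k + 1 + (j + 1) := ⟨M.card - (k + 2), by omega⟩
    have e1 : M.card - (k + 1) = j + 1 := by omega
    rw [e1] at hsum
    have h5 : M.card * h = (k + 1) * h + (j + 1) * h := by rw [hj]; ring
    have h6 : (W.filter (fun v => 0 < y v)).card * (j + 1) ≤ h * (j + 1) := by
      have : (j + 1) * h = h * (j + 1) := mul_comm _ _
      omega
    exact Nat.le_of_mul_le_mul_right h6 (by omega)
  have h1 : ∀ x ∈ W, y x ≤ if 0 < y x then ((k : ℤ) - 1) else 0 := by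
    intro x hx
    split_ifs with hyx
    · have h2 := law_le hβ hR hL hx
      have h3 := hno x hx
      omega
    · omega
  have h2 := sum_le_sum h1
  rw [← sum_filter, sum_const, nsmul_eq_mul] at h2
  have hk' : (0 : ℤ) ≤ (k : ℤ) - 1 := by omega
  have h4 : ((W.filter (fun v => 0 < y v)).card : ℤ) * (k - 1) ≤ h * (k - 1) :=
    mul_le_mul_of_nonneg_right (by exact_mod_cast hf) hk'
  linarith
end ST8

section ST9
open Classical
variable [DecidableEq V]

/-- indicator weight of the colour set `B` -/
noncomputable def bt {q : ℕ} (f : Sym2 V → Fin q) (B : Finset (Fin q)) (u v : V) : ℤ :=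
  if u ≠ v ∧ f s(u, v) ∈ B then 1 else 0

lemma bt_wt {q : ℕ} (f : Sym2 V → Fin q) (B : Finset (Fin q)) : Wt (bt f B) where
  symm := by
    intro u v
    unfold bt
    rw [Sym2.eq_swap]
    simp only [ne_comm]
  diag := by intro v; simp [bt]
  nonneg := by intro u v; unfold bt; split_ifs <;> simp
  le_one := by intro u v; unfold bt; split_ifs <;> simp

lemma bt_sum {q : ℕ} (f : Sym2 V → Fin q) (B : Finset (Fin q)) (u v : V) :
    bt f B u v = ∑ c ∈ B, bt f {c} u v := by
  unfold bt
  by_cases h : u = v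
  · simp [h]
  · simp [h]

lemma c2_bt_sum {q : ℕ} (f : Sym2 V → Fin q) (B : Finset (Fin q)) (K : Finset V) :
    c2 (bt f B) K = ∑ c ∈ B, c2 (bt f {c}) K := by
  unfold c2 dd
  rw [sum_comm (s := B)]
  refine sum_congr rfl (fun u _ => ?_)
  rw [sum_comm (s := B)]
  exact sum_congr rfl (fun v _ => bt_sum f B u v)

lemma GFree_bt {G : SimpleGraph V} {r q : ℕ} {W : Finset V} (f : Sym2 V → Fin q)
    (h : ∀ c, GFree G r (bt f {c}) W) (B : Finset (Fin q)) : GFree G r (bt f B) W := by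
  intro S hS hc T1 T2 h1 h2
  simp only [c2_bt_sum f B]
  rw [sum_comm, sum_comm (s := T2)]
  exact sum_congr rfl (fun c _ => h c S hS hc T1 T2 h1 h2)

lemma bt_eq_one {q : ℕ} {f : Sym2 V → Fin q} {B : Finset (Fin q)} {u v : V} (h : bt f B u v = 1) :
    u ≠ v ∧ f s(u, v) ∈ B := by
  by_contra hn
  simp [bt, hn] at h

lemma bt_of {q : ℕ} {f : Sym2 V → Fin q} {B : Finset (Fin q)} {u v : V} (h : u ≠ v) (h' : f s(u, v) ∈ B) :
    bt f B u v = 1 := by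
  simp [bt, h, h']

lemma bt_zero {q : ℕ} {f : Sym2 V → Fin q} {B : Finset (Fin q)} {u v : V} (h : u ≠ v → f s(u, v) ∉ B) :
    bt f B u v = 0 := by
  unfold bt
  rw [if_neg]
  rintro ⟨h1, h2⟩
  exact h h1 h2

/-- edges in `K` with colour in `B` -/
lemma c2_bridge {q : ℕ} (f : Sym2 V → Fin q) (B : Finset (Fin q)) (K : Finset V) :
    c2 (bt f B) K = 2 * ((K.sym2.filter fun e => ¬ e.IsDiag ∧ f e ∈ B).card : ℤ) := by
  induction K using Finset.induction_on with
  | empty => simp [c2]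
  | insert v K hv ih =>
    rw [c2_insert (bt_wt f B) hv, ih, sym2_insert, filter_union, card_union_of_disjoint]
    · have h1 : (((insert v K).image (fun b => s(v, b))).filter fun e => ¬ e.IsDiag ∧ f e ∈ B) =
          (K.filter (fun b => f s(v, b) ∈ B)).image (fun b => s(v, b)) := by
        ext e
        simp only [mem_filter, mem_image, mem_insert]
        constructor
        · rintro ⟨⟨b, hb, rfl⟩, h2, h3⟩
          simp only [Sym2.mk_isDiag_iff] at h2
          rcases hb with rfl | hb
          · exact absurd rfl h2
          · exact ⟨b, ⟨hb, h3⟩, rfl⟩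
        · rintro ⟨b, ⟨hb, h3⟩, rfl⟩
          refine ⟨⟨b, Or.inr hb, rfl⟩, ?_, h3⟩
          simp only [Sym2.mk_isDiag_iff]
          rintro rfl
          exact hv hb
      rw [h1, card_image_of_injective]
      · have h2 : dd (bt f B) v K = ((K.filter (fun b => f s(v, b) ∈ B)).card : ℤ) := by
          unfold dd
          rw [card_filter]
          push_cast
          refine sum_congr rfl (fun b hb => ?_)
          have : v ≠ b := by rintro rfl; exact hv hb
          simp [bt, this]
        rw [h2]
        push_cast
        ring
      · intro a b hab
        have : a = b ∨ v = b ∧ a = v := by simpa using hab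
        rcases this with h | ⟨h, h'⟩
        · exact h
        · exact h'.trans h
    · rw [disjoint_left]
      intro e he he'
      simp only [mem_filter, mem_image] at he he'
      obtain ⟨⟨b, hb, rfl⟩, -⟩ := he
      have := he'.1
      rw [mk_mem_sym2_iff] at this
      exact hv this.1

lemma c2_univ {q : ℕ} (f : Sym2 V → Fin q) (K : Finset V) :
    c2 (bt f univ) K = K.card * (K.card - 1) := by
  induction K using Finset.induction_on with
  | empty => simp [c2]
  | insert v K hv ih =>
    have h2 : dd (bt f univ) v K = (K.card : ℤ) := by
      unfold dd
      rw [sum_congr rfl (fun b hb => bt_of (f := f) (B := univ) (u := v) (v := b)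
        (by rintro rfl; exact hv hb) (mem_univ _))]
      simp
    rw [c2_insert (bt_wt f univ) hv, ih, h2, card_insert_of_notMem hv]
    push_cast
    ring

/-- colours appearing in `A` -/
noncomputable def cols {q : ℕ} (f : Sym2 V → Fin q) (A : Finset V) : Finset (Fin q) :=
  univ.filter (fun c => ∃ x ∈ A, ∃ y ∈ A, x ≠ y ∧ f s(x, y) = c)

lemma mem_cols {q : ℕ} {f : Sym2 V → Fin q} {A : Finset V} {x y : V} (hx : x ∈ A) (hy : y ∈ A) (h : x ≠ y) :
    f s(x, y) ∈ cols f A := by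
  simp only [cols, mem_filter, mem_univ, true_and]
  exact ⟨x, hx, y, hy, h, rfl⟩

lemma c2_cols {q : ℕ} {f : Sym2 V → Fin q} {A : Finset V} {c : Fin q} (hc : c ∈ cols f A) :
    2 ≤ c2 (bt f {c}) A := by
  simp only [cols, mem_filter, mem_univ, true_and] at hc
  obtain ⟨x, hx, y, hy, hxy, rfl⟩ := hc
  have h1 : 0 < (A.sym2.filter fun e => ¬ e.IsDiag ∧ f e ∈ ({f s(x, y)} : Finset (Fin q))).card := by
    rw [card_pos]
    refine ⟨s(x, y), ?_⟩
    rw [mem_filter, mk_mem_sym2_iff]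
    simp [hx, hy, hxy]
  rw [c2_bridge]
  omega

lemma cols_card {q : ℕ} {f : Sym2 V → Fin q} {A : Finset V} {S : Finset (Fin q)} (hS : S ⊆ cols f A) :
    2 * (S.card : ℤ) ≤ c2 (bt f S) A := by
  rw [c2_bt_sum]
  have := card_nsmul_le_sum S (fun c => c2 (bt f {c}) A) 2 (fun c hc => c2_cols (hS hc))
  simp only [nsmul_eq_mul] at this
  linarith

lemma c2_mono_univ {q : ℕ} (f : Sym2 V → Fin q) (A : Finset V) (S : Finset (Fin q)) :
    c2 (bt f S) A + c2 (bt f Sᶜ) A = A.card * (A.card - 1) := by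
  rw [← c2_univ f A, c2_bt_sum f S, c2_bt_sum f Sᶜ, c2_bt_sum f univ]
  exact sum_add_sum_compl S _

lemma cols_card' {q : ℕ} (f : Sym2 V → Fin q) (A : Finset V) :
    2 * ((cols f A).card : ℤ) ≤ A.card * (A.card - 1) := by
  have h1 := cols_card (f := f) (A := A) (Subset.refl _)
  have h2 := c2_mono_univ f A (cols f A)
  have h3 := c2_nonneg (bt_wt f (cols f A)ᶜ) A
  linarith

lemma bt_compl_cols {q : ℕ} {f : Sym2 V → Fin q} {A Q : Finset V} (hQ : Q ⊆ A) :
    ∀ u ∈ Q, ∀ x ∈ Q, bt f (cols f A)ᶜ u x = 0 := by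
  intro u hu x hx
  apply bt_zero
  intro hux
  rw [mem_compl, not_not]
  exact mem_cols (hQ hu) (hQ hx) hux

lemma three_cols {q : ℕ} {M : Finset V} (f : Sym2 V → Fin q) (hM : 1 < M.card)
    (H : ∀ u ∈ M, ∀ w ∈ M, ∀ a ∈ M, ∀ b ∈ M, u ≠ w → u ≠ a → u ≠ b → w ≠ a → w ≠ b → a ≠ b →
      f s(u, a) ≠ f s(w, a) → f s(u, b) = f s(u, a) ∧ f s(w, b) = f s(w, a)) :
    (cols f M).card ≤ 3 := by
  suffices h : ∃ c1 c2 c3, cols f M ⊆ {c1, c2, c3} by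
    obtain ⟨c1, c2, c3, h⟩ := h
    exact (card_le_card h).trans card_le_three
  by_cases hc : ∃ a ∈ M, ∃ u ∈ M, ∃ w ∈ M, a ≠ u ∧ a ≠ w ∧ u ≠ w ∧ f s(u, a) ≠ f s(w, a)
  · obtain ⟨a, ha, u, hu, w, hw, hau, haw, huw, hne⟩ := hc
    refine ⟨f s(u, a), f s(w, a), f s(u, w), ?_⟩
    have h1 : ∀ z ∈ M, z ≠ u → z ≠ w → f s(u, z) = f s(u, a) ∧ f s(w, z) = f s(w, a) := by
      intro z hz hzu hzw
      by_cases hza : z = a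
      · subst hza; exact ⟨rfl, rfl⟩
      · exact H u hu w hw a ha z hz huw hau.symm hzu.symm haw.symm hzw.symm (Ne.symm hza) hne
    intro c hc
    simp only [cols, mem_filter, mem_univ, true_and] at hc
    obtain ⟨x, hx, y, hy, hxy, rfl⟩ := hc
    simp only [mem_insert, mem_singleton]
    by_cases hxu : x = u
    · subst hxu
      by_cases hyw : y = w
      · subst hyw; tauto
      · exact Or.inl (h1 y hy hxy.symm hyw).1
    by_cases hxw : x = w
    · subst hxw
      by_cases hyu : y = u
      · subst hyu; rw [Sym2.eq_swap]; tauto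
      · exact Or.inr (Or.inl (h1 y hy hyu hxy.symm).2)
    by_cases hyu : y = u
    · subst hyu
      rw [Sym2.eq_swap]
      exact Or.inl (h1 x hx hxu hxw).1
    by_cases hyw : y = w
    · subst hyw
      rw [Sym2.eq_swap]
      exact Or.inr (Or.inl (h1 x hx hxu hxw).2)
    by_cases h2 : f s(y, x) = f s(u, x)
    · left
      rw [Sym2.eq_swap, h2]
      exact (h1 x hx hxu hxw).1
    · right; left
      have := (H y hy u hu x hx w hw hyu hxy.symm hyw (Ne.symm hxu) huw hxw h2).1
      rw [Sym2.eq_swap, ← this, Sym2.eq_swap]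
      exact (h1 y hy hyu hyw).2
  · push Not at hc
    obtain ⟨a, ha, b, hb, hab⟩ := one_lt_card.1 hM
    refine ⟨f s(b, a), f s(b, a), f s(b, a), ?_⟩
    have h1 : ∀ z ∈ M, z ≠ a → f s(z, a) = f s(b, a) := by
      intro z hz hza
      by_cases hzb : z = b
      · rw [hzb]
      · exact hc a ha z hz b hb hza.symm hab hzb
    intro c hc'
    simp only [cols, mem_filter, mem_univ, true_and] at hc'
    obtain ⟨x, hx, y, hy, hxy, rfl⟩ := hc'
    simp only [mem_insert, mem_singleton, or_self]
    by_cases hxa : x = a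
    · subst hxa; rw [Sym2.eq_swap]; exact h1 y hy hxy.symm
    · by_cases hya : y = a
      · subst hya; exact h1 x hx hxy
      · rw [← h1 x hx hxa, Sym2.eq_swap, Sym2.eq_swap (a := x)]
        exact hc x hx y hy a ha hxy hxa hya

lemma bt_diff {q : ℕ} {M : Finset V} (f : Sym2 V → Fin q)
    (H : ∀ c : Fin q, ∀ u ∈ M, ∀ w ∈ M, ∀ a ∈ M, ∀ b ∈ M, u ≠ w → u ≠ a → u ≠ b → w ≠ a → w ≠ b → a ≠ b →
      bt f {c} u a - bt f {c} w a = bt f {c} u b - bt f {c} w b) :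
    ∀ u ∈ M, ∀ w ∈ M, ∀ a ∈ M, ∀ b ∈ M, u ≠ w → u ≠ a → u ≠ b → w ≠ a → w ≠ b → a ≠ b →
      f s(u, a) ≠ f s(w, a) → f s(u, b) = f s(u, a) ∧ f s(w, b) = f s(w, a) := by
  intro u hu w hw a ha b hb huw hua hub hwa hwb hab hne
  have h1 := H (f s(u, a)) u hu w hw a ha b hb huw hua hub hwa hwb hab
  have h2 := H (f s(w, a)) u hu w hw a ha b hb huw hua hub hwa hwb hab
  simp only [bt, ne_eq, hua, hub, hwa, hwb, not_false_eq_true, true_and, mem_singleton, hne, hne.symm,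
    if_true, if_false] at h1 h2
  constructor
  · by_contra hx
    rw [if_neg hx] at h1
    split_ifs at h1 <;> omega
  · by_contra hx
    rw [if_neg hx] at h2
    split_ifs at h2 <;> omega

/-- a common zero clique gives the bound -/
lemma struct_zero {G : SimpleGraph V} {k C h q : ℕ} {W : Finset V} {f : Sym2 V → Fin q}
    (hG : ∀ c, GFree G (k + 1) (bt f {c}) W) (hR : Rob G (k + 1) C W) (hC : 5 * (k + 1) ≤ C) (hk : 1 ≤ k)
    (hh : ∀ v ∈ W, (W.filter (fun u => ¬ G.Adj v u)).card ≤ h) (hW : (k + 1) * h ≤ W.card)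
    {A : Finset V} (hA : TC G (k + 2) W A) (B : Finset (Fin q))
    (hA0 : ∀ u ∈ A, ∀ x ∈ A, bt f B u x = 0) :
    ∃ y, Law G k W (bt f B) y ∧ ((∃ v ∈ W, y v = k) ∨ ∑ x ∈ W, y x ≤ (k - 1) * h) := by
  obtain ⟨y, hL, hy⟩ := zero_clique_law (bt_wt f B) (GFree_bt f hG B) hR hC hk hA hA0
  refine ⟨y, hL, ?_⟩
  by_cases hv : ∃ v ∈ W, y v = k
  · exact Or.inl hv
  · push Not at hv
    exact Or.inr (law_Z2 (bt_wt f B) hR hL hk hh hW hA hy hv)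

theorem struct_main {G : SimpleGraph V} {k C h q : ℕ} {W : Finset V} {f : Sym2 V → Fin q}
    (hG : ∀ c, GFree G (k + 1) (bt f {c}) W) (hR : Rob G (k + 1) C W) (hC : 5 * (k + 1) ≤ C) (hk : 2 ≤ k)
    (hh : ∀ v ∈ W, (W.filter (fun u => ¬ G.Adj v u)).card ≤ h) (hW : (k + 1) * h ≤ W.card) :
    (∃ B : Finset (Fin q), 2 * (Bᶜ.card : ℤ) ≤ (k + 1) * k ∧ ∃ y, Law G k W (bt f B) y ∧ ∑ x ∈ W, y x ≤ k * h) ∨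
    (W.card ≤ (k + 2) * h ∧ (2 * (q : ℤ) ≤ (k + 2) * (k + 1) ∨
      (∃ c : Fin q, ∀ u ∈ W, ∀ v ∈ W, G.Adj u v → f s(u, v) ≠ c) ∨
      ∃ B : Finset (Fin q), 2 * (Bᶜ.card : ℤ) ≤ (k + 1) * k + 2 ∧
        ∃ y, Law G k W (bt f B) y ∧ ∑ x ∈ W, y x ≤ (k - 1) * h)) := by
  obtain ⟨A0, hA0⟩ : ∃ A, TC G (k + 2) W A := by
    obtain ⟨z, hz, -⟩ := hR ∅ (empty_subset _) (by simp) ∅ (by simp)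
    obtain ⟨A, hA, -⟩ := exists_clique_at hR hz
    exact ⟨A, hA⟩
  have hk2 : (2 : ℤ) ≤ k := by exact_mod_cast hk
  by_cases hreg : W.card ≤ (k + 2) * h
  · by_cases hall : ∀ c, c ∈ cols f A0
    · right
      refine ⟨hreg, Or.inl ?_⟩
      have h1 := cols_card' f A0
      rw [eq_univ_iff_forall.2 hall, card_univ, Fintype.card_fin, hA0.2.1] at h1
      push_cast at h1
      linarith
    push Not at hall
    obtain ⟨c, hc⟩ := hall
    by_cases hcW : ∀ u ∈ W, ∀ v ∈ W, G.Adj u v → f s(u, v) ≠ c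
    · right
      exact ⟨hreg, Or.inr (Or.inl ⟨c, hcW⟩)⟩
    push Not at hcW
    obtain ⟨u, hu, v, hv, huv, hfc⟩ := hcW
    obtain ⟨A, hA, huA, hvA⟩ := exists_clique_through hR hu hv huv
    obtain ⟨yc, hLc, -⟩ := zero_clique_law (bt_wt f {c}) (hG c) hR hC (by omega) hA0 (by
      intro x hx y hy
      apply bt_zero
      intro hxy hm
      rw [mem_singleton] at hm
      exact hc (hm ▸ mem_cols hx hy hxy))
    obtain ⟨κ, -, hκ⟩ := law_K1 (bt_wt f {c}) hLc hA
    have hcA : c ∈ cols f A := hfc ▸ mem_cols huA hvA huv.ne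
    have h1 := c2_cols hcA
    have hκ1 : 1 ≤ κ := by
      by_contra hlt
      have : 2 * ((k : ℤ) + 1) * κ ≤ 0 := mul_nonpos_of_nonneg_of_nonpos (by positivity) (by omega)
      linarith
    have hcard : 2 * ((cols f A).card : ℤ) ≤ (k + 1) * k + 2 := by
      have e1 := cols_card (f := f) (A := A) (erase_subset c (cols f A))
      have e2 := c2_mono_univ f A {c}
      have e3 : c2 (bt f ((cols f A).erase c)) A ≤ c2 (bt f {c}ᶜ) A := by
        rw [c2_bt_sum, c2_bt_sum f {c}ᶜ]
        apply sum_le_sum_of_subset_of_nonneg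
        · intro x hx
          simp only [mem_compl, mem_singleton]
          exact (mem_erase.1 hx).1
        · intro i _ _
          exact c2_nonneg (bt_wt f {i}) A
      have e4 : ((cols f A).card : ℤ) = ((cols f A).erase c).card + 1 := by
        rw [← card_erase_add_one hcA]; push_cast; rfl
      rw [hA.2.1] at e2
      push_cast at e2
      have e5 : 2 * ((k : ℤ) + 1) * 1 ≤ 2 * (k + 1) * κ := mul_le_mul_of_nonneg_left hκ1 (by positivity)
      rw [← hκ] at e5
      linarith
    obtain ⟨y, hL, hy⟩ := struct_zero hG hR hC (by omega) hh hW hA (cols f A)ᶜ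
      (bt_compl_cols (Subset.refl _))
    rcases hy with ⟨v, hv, hyv⟩ | hy
    · left
      obtain ⟨A', hA', hvA'⟩ := exists_clique_at hR hv
      obtain ⟨s1, s2, -⟩ := law_star (bt_wt f _) hL (by omega) hyv hA' hvA'
      set Q := A'.erase v with hQ
      have hQT : TC G (k + 1) W Q :=
        hA'.sub (erase_subset _ _) (by rw [card_erase_of_mem hvA', hA'.2.1]; rfl)
      refine ⟨(cols f Q)ᶜ, ?_, ?_⟩
      · rw [compl_compl]
        have := cols_card' f Q
        rw [hQT.2.1] at this
        push_cast at this
        linarith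
      have hone : ∀ x ∈ Q, bt f (cols f Q)ᶜ v x = 1 := by
        intro x hx
        obtain ⟨n1, n2⟩ := bt_eq_one (s1 x hx)
        refine bt_of n1 ?_
        rw [mem_compl]
        intro hm
        simp only [cols, mem_filter, mem_univ, true_and] at hm
        obtain ⟨a, ha, b, hb, hab, hfab⟩ := hm
        have := s2 a ha b hb
        rw [bt_of hab (hfab ▸ n2)] at this
        exact one_ne_zero this
      have hvQ : ∀ x ∈ Q, G.Adj v x := fun x hx =>
        hA'.2.2 v hvA' x (mem_of_mem_erase hx) (mem_erase.1 hx).1.symm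
      have hz := bt_compl_cols (f := f) (Subset.refl Q)
      obtain ⟨y', hL', -⟩ := lemma_Y (bt_wt f _) (GFree_bt f hG _) hR hC (by omega) hQT hz hv hvQ 1 hone
      refine ⟨y', hL', law_Z1 (bt_wt f _) hR hL' (by omega) hh hv ?_⟩
      obtain ⟨κ', k1, k2⟩ := law_K1 (bt_wt f _) hL' hA'
      have hd : dd (bt f (cols f Q)ᶜ) v A' = k + 1 := by
        have := dd_insert (β := bt f (cols f Q)ᶜ) (v := v) (notMem_erase v A')
        rw [insert_erase hvA', (bt_wt f _).diag, zero_add] at this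
        rw [this]
        unfold dd
        rw [sum_congr rfl hone, sum_const, hQT.2.1]
        simp
      rw [c2_erase (bt_wt f _) hvA', c2_zero hz, hd] at k2
      have : κ' = 1 := by
        have hp : (0 : ℤ) < 2 * (k + 1) := by positivity
        nlinarith
      rw [k1 v hvA', hd, this]
      ring
    · right
      refine ⟨hreg, Or.inr (Or.inr ⟨(cols f A)ᶜ, ?_, y, hL, hy⟩)⟩
      rw [compl_compl]
      exact hcard
  · left
    push Not at hreg
    obtain ⟨z, hz, hzA⟩ : ∃ z ∈ W, ∀ x ∈ A0, G.Adj x z := by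
      by_contra hno
      push Not at hno
      have h1 : W ⊆ A0.biUnion (fun x => W.filter (fun u => ¬ G.Adj x u)) := by
        intro z hz
        obtain ⟨x, hx, hxz⟩ := hno z hz
        rw [mem_biUnion]
        exact ⟨x, hx, mem_filter.2 ⟨hz, hxz⟩⟩
      have h2 := (card_le_card h1).trans (card_biUnion_le_card_mul _ _ h (fun x hx => hh x (hA0.1 hx)))
      rw [hA0.2.1] at h2
      omega
    have hM := hA0.insert hz (fun x hx => (hzA x hx).symm)
    have h3 := three_cols f (by rw [hM.2.1]; omega) (bt_diff f (fun c u hu w hw a ha b hb n1 n2 n3 n4 n5 n6 =>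
      L_M (bt_wt f {c}) (hG c) hR hC (by omega) hM hu hw ha hb n1 n2 n3 n4 n5 n6))
    obtain ⟨y, hL, hy⟩ := struct_zero hG hR hC (by omega) hh hW hA0 (cols f (insert z A0))ᶜ
      (bt_compl_cols (subset_insert _ _))
    refine ⟨(cols f (insert z A0))ᶜ, ?_, y, hL, ?_⟩
    · rw [compl_compl]
      have : ((cols f (insert z A0)).card : ℤ) ≤ 3 := by exact_mod_cast h3
      nlinarith
    · rcases hy with ⟨v, hv, hyv⟩ | hy
      · exact law_Z1 (bt_wt f _) hR hL (by omega) hh hv hyv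
      · have : (0 : ℤ) ≤ h := by positivity
        linarith
end ST9

section ST10
open Classical
variable [DecidableEq V]

lemma tiling_union {G : SimpleGraph V} {r : ℕ} (hr : 1 ≤ r) {T1 T2 : Finset (Finset V)} {W1 W2 : Finset V}
    (h1 : IsKrTilingOn G r T1 W1) (h2 : IsKrTilingOn G r T2 W2) (hd : Disjoint W1 W2) :
    IsKrTilingOn G r (T1 ∪ T2) (W1 ∪ W2) ∧
      ∀ φ : Finset V → ℤ, ∑ K ∈ T1 ∪ T2, φ K = ∑ K ∈ T1, φ K + ∑ K ∈ T2, φ K := by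
  have s1 : ∀ K ∈ T1, K ⊆ W1 := fun K hK => h1.2.2 ▸ subset_biUnion_of_mem id hK
  have s2 : ∀ K ∈ T2, K ⊆ W2 := fun K hK => h2.2.2 ▸ subset_biUnion_of_mem id hK
  have hdd : ∀ K ∈ T1, ∀ K' ∈ T2, Disjoint K K' := fun K hK K' hK' =>
    disjoint_of_subset_left (s1 K hK) (disjoint_of_subset_right (s2 K' hK') hd)
  refine ⟨⟨?_, ?_, ?_⟩, ?_⟩
  · intro K hK
    rcases mem_union.1 hK with h | h
    · exact h1.1 K h
    · exact h2.1 K h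
  · intro K hK K' hK' hne
    rcases mem_union.1 hK with h | h <;> rcases mem_union.1 hK' with h' | h'
    · exact h1.2.1 K h K' h' hne
    · exact hdd K h K' h'
    · exact (hdd K' h' K h).symm
    · exact h2.2.1 K h K' h' hne
  · rw [union_biUnion, h1.2.2, h2.2.2]
  · intro φ
    apply sum_union
    rw [disjoint_left]
    intro K hK hK'
    have := hdd K hK K hK'
    rw [disjoint_self_iff_empty] at this
    have hc := ((SimpleGraph.isNClique_iff _).1 (h1.1 K hK)).2
    rw [this, card_empty] at hc
    omega

lemma tiling_empty {G : SimpleGraph V} {r : ℕ} : IsKrTilingOn G r ∅ (∅ : Finset V) :=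
  ⟨by simp, by simp, by simp⟩

lemma tiling_biUnion {G : SimpleGraph V} {r : ℕ} (hr : 1 ≤ r) (τ : Finset V → Finset (Finset V))
    (𝒮 : Finset (Finset V)) : (∀ S ∈ 𝒮, IsKrTilingOn G r (τ S) S) →
    (∀ S ∈ 𝒮, ∀ S' ∈ 𝒮, S ≠ S' → Disjoint S S') →
    ∃ T, IsKrTilingOn G r T (𝒮.biUnion id) ∧
      ∀ φ : Finset V → ℤ, ∑ K ∈ T, φ K = ∑ S ∈ 𝒮, ∑ K ∈ τ S, φ K := by
  induction 𝒮 using Finset.induction_on with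
  | empty => intro _ _; exact ⟨∅, by simpa using tiling_empty, by simp⟩
  | insert S 𝒮 hS ih =>
    intro h1 h2
    obtain ⟨T, hT, hφ⟩ := ih (fun S' hS' => h1 S' (mem_insert_of_mem hS'))
      (fun a ha b hb => h2 a (mem_insert_of_mem ha) b (mem_insert_of_mem hb))
    have hd : Disjoint S (𝒮.biUnion id) := by
      rw [disjoint_biUnion_right]
      intro S' hS'
      exact h2 S (mem_insert_self _ _) S' (mem_insert_of_mem hS') (by rintro rfl; exact hS hS')
    obtain ⟨u1, u2⟩ := tiling_union hr (h1 S (mem_insert_self _ _)) hT hd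
    refine ⟨τ S ∪ T, ?_, ?_⟩
    · rw [biUnion_insert]; exact u1
    · intro φ
      rw [u2, sum_insert hS, hφ]

lemma tiling_card {G : SimpleGraph V} {r : ℕ} {T : Finset (Finset V)} {W : Finset V}
    (h : IsKrTilingOn G r T W) : W.card = T.card * r := by
  rw [← h.2.2, card_biUnion (t := id) (fun K hK K' hK' hne => h.2.1 K hK K' hK' hne)]
  simp only [id]
  rw [sum_congr rfl (fun K hK => ((SimpleGraph.isNClique_iff _).1 (h.1 K hK)).2)]
  simp

lemma tiling_c2_univ {G : SimpleGraph V} {k q : ℕ} {T : Finset (Finset V)} {W : Finset V} (f : Sym2 V → Fin q)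
    (h : IsKrTilingOn G (k + 1) T W) : ∑ K ∈ T, c2 (bt f univ) K = W.card * k := by
  have : ∀ K ∈ T, c2 (bt f univ) K = (k + 1) * k := by
    intro K hK
    rw [c2_univ, ((SimpleGraph.isNClique_iff _).1 (h.1 K hK)).2]
    push_cast; ring
  rw [sum_congr rfl this, tiling_card h, sum_const, nsmul_eq_mul]
  push_cast; ring

lemma tiling_c2_le {G : SimpleGraph V} {k q : ℕ} {T : Finset (Finset V)} {W : Finset V} (f : Sym2 V → Fin q)
    (h : IsKrTilingOn G (k + 1) T W) (B : Finset (Fin q)) : ∑ K ∈ T, c2 (bt f B) K ≤ W.card * k := by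
  rw [← tiling_c2_univ f h]
  apply sum_le_sum
  intro K _
  rw [c2_bt_sum, c2_bt_sum f univ]
  exact sum_le_sum_of_subset_of_nonneg (subset_univ _) (fun i _ _ => c2_nonneg (bt_wt f {i}) K)

lemma tiling_c2_split {q : ℕ} {T : Finset (Finset V)} (f : Sym2 V → Fin q)
    (B : Finset (Fin q)) : ∑ K ∈ T, c2 (bt f B) K = ∑ c ∈ B, ∑ K ∈ T, c2 (bt f {c}) K := by
  rw [sum_comm]
  exact sum_congr rfl (fun K _ => c2_bt_sum f B K)

lemma tiling_law {G : SimpleGraph V} {k q : ℕ} {T : Finset (Finset V)} {W : Finset V} {f : Sym2 V → Fin q}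
    (h : IsKrTilingOn G (k + 1) T W) {B : Finset (Fin q)} {y : V → ℤ} (hL : Law G k W (bt f B) y) :
    ∑ K ∈ T, c2 (bt f B) K = 2 * ∑ x ∈ W, y x := by
  have h1 : ∀ K ∈ T, c2 (bt f B) K = 2 * ∑ x ∈ K, y x := by
    intro K hK
    exact (hL K (TC_of_nclique (h.2.2 ▸ subset_biUnion_of_mem id hK) (h.1 K hK))).symm
  rw [sum_congr rfl h1, ← mul_sum]
  congr 1
  conv_rhs => rw [← h.2.2]
  rw [sum_biUnion (t := id) (fun K hK K' hK' hne => h.2.1 K hK K' hK' hne)]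
  rfl

/-- gadgets -/
def Gad {q : ℕ} (G : SimpleGraph V) (r : ℕ) (f : Sym2 V → Fin q) (S : Finset V) : Prop :=
  S.card ≤ 3 * r ∧ ∃ c T1 T2, IsKrTilingOn G r T1 S ∧ IsKrTilingOn G r T2 S ∧
    ∑ K ∈ T1, c2 (bt f {c}) K < ∑ K ∈ T2, c2 (bt f {c}) K

lemma Gad.ne {q : ℕ} {G : SimpleGraph V} {r : ℕ} (hr : 1 ≤ r) {f : Sym2 V → Fin q} {S : Finset V} (h : Gad G r f S) :
    S.Nonempty := by
  by_contra hS
  rw [not_nonempty_iff_eq_empty] at hS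
  subst hS
  obtain ⟨-, c, T1, T2, h1, h2, h3⟩ := h
  have e1 := tiling_card h1
  have e2 := tiling_card h2
  rw [card_empty] at e1 e2
  have t1 : T1 = ∅ := by
    rcases Nat.mul_eq_zero.1 e1.symm with h | h
    · exact card_eq_zero.1 h
    · omega
  have t2 : T2 = ∅ := by
    rcases Nat.mul_eq_zero.1 e2.symm with h | h
    · exact card_eq_zero.1 h
    · omega
  rw [t1, t2] at h3
  exact lt_irrefl _ h3

lemma gad_family [Fintype V] {q : ℕ} (G : SimpleGraph V) {r : ℕ} (hr : 1 ≤ r) (f : Sym2 V → Fin q) (g : ℕ) :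
    ∃ 𝒮 : Finset (Finset V), (∀ S ∈ 𝒮, Gad G r f S) ∧ (∀ S ∈ 𝒮, ∀ S' ∈ 𝒮, S ≠ S' → Disjoint S S') ∧
      𝒮.card ≤ g ∧ (𝒮.card = g ∨ ∀ c, GFree G r (bt f {c}) (univ \ 𝒮.biUnion id)) := by
  obtain ⟨P, hP⟩ : ∃ P : Finset (Finset V) → Prop, ∀ 𝒮, P 𝒮 ↔ ((∀ S ∈ 𝒮, Gad G r f S) ∧
      (∀ S ∈ 𝒮, ∀ S' ∈ 𝒮, S ≠ S' → Disjoint S S') ∧ 𝒮.card ≤ g) := ⟨_, fun _ => Iff.rfl⟩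
  obtain ⟨𝒮, hM, hmax⟩ := exists_max_image (univ.filter P) card
    ⟨∅, mem_filter.2 ⟨mem_univ _, (hP _).2 ⟨by simp, by simp, by simp⟩⟩⟩
  obtain ⟨m1, m2, m3⟩ := (hP _).1 (mem_filter.1 hM).2
  refine ⟨𝒮, m1, m2, m3, ?_⟩
  by_cases hg : 𝒮.card = g
  · exact Or.inl hg
  right
  intro c
  have key : ∀ S ⊆ univ \ 𝒮.biUnion id, ¬ Gad G r f S := by
    intro S hS hgad
    have hd : ∀ S' ∈ 𝒮, Disjoint S S' := by
      intro S' hS'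
      rw [disjoint_left]
      intro x hx hx'
      exact (mem_sdiff.1 (hS hx)).2 (mem_biUnion.2 ⟨S', hS', hx'⟩)
    have hnot : S ∉ 𝒮 := by
      intro hm
      have := hd S hm
      rw [disjoint_self_iff_empty] at this
      exact (hgad.ne hr).ne_empty this
    have := hmax (insert S 𝒮) (mem_filter.2 ⟨mem_univ _, (hP _).2 ⟨?_, ?_, ?_⟩⟩)
    · rw [card_insert_of_notMem hnot] at this; omega
    · intro S' hS'
      rcases mem_insert.1 hS' with rfl | h
      · exact hgad
      · exact m1 S' h
    · intro A hA B hB hne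
      rcases mem_insert.1 hA with hA | hA <;> rcases mem_insert.1 hB with hB | hB
      · exact absurd (hA.trans hB.symm) hne
      · rw [hA]; exact hd B hB
      · rw [hB]; exact (hd A hA).symm
      · exact m2 A hA B hB hne
    · rw [card_insert_of_notMem hnot]; omega
  intro S hS hc T1 T2 h1 h2
  rcases lt_trichotomy (∑ K ∈ T1, c2 (bt f {c}) K) (∑ K ∈ T2, c2 (bt f {c}) K) with h | h | h
  · exact absurd ⟨hc, c, T1, T2, h1, h2, h⟩ (key S hS)
  · exact h
  · exact absurd ⟨hc, c, T2, T1, h2, h1, h⟩ (key S hS)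

lemma rob_of {G : SimpleGraph V} {r C h : ℕ} {W : Finset V}
    (hh : ∀ v ∈ W, (W.filter (fun u => ¬ G.Adj v u)).card ≤ h) (hW : r * h + C < W.card) : Rob G r C W := by
  intro S hS hSc F hF
  by_contra hno
  push Not at hno
  have h1 : W ⊆ F ∪ S.biUnion (fun x => W.filter (fun u => ¬ G.Adj x u)) := by
    intro z hz
    rw [mem_union]
    by_cases hzF : z ∈ F
    · exact Or.inl hzF
    · right
      obtain ⟨s, hs, hsz⟩ := hno z hz hzF
      exact mem_biUnion.2 ⟨s, hs, mem_filter.2 ⟨hz, hsz⟩⟩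
  have h2 := card_le_card h1
  have h3 := card_union_le F (S.biUnion (fun x => W.filter (fun u => ¬ G.Adj x u)))
  have h4 := card_biUnion_le_card_mul S (fun x => W.filter (fun u => ¬ G.Adj x u)) h (fun x hx => hh x (hS hx))
  have h5 : S.card * h ≤ r * h := Nat.mul_le_mul_right _ hSc
  omega

set_option maxHeartbeats 2000000 in
theorem core [Fintype V] {G : SimpleGraph V} {k h g q : ℕ} {ε z : ℝ} (hk : 2 ≤ k) (hq : 2 ≤ q) (hε : 0 < ε)
    (f : Sym2 V → Fin q) (hdiv : (k + 1) ∣ Fintype.card V)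
    (hh : ∀ v : V, (univ.filter (fun u => ¬ G.Adj v u)).card ≤ h)
    (h1 : ((k : ℝ) + 1) * h + (k + 1) * (ε * Fintype.card V) ≤ Fintype.card V)
    (hP : 3 * ((k : ℝ) + 1) * g + 5 * (k + 1) < ε * Fintype.card V)
    (hP2 : 3 * ((k : ℝ) + 1) * g * (2 * q) < Fintype.card V)
    (hz0 : 0 < z) (hz1 : q * z ≤ 1 / 2) (hz : (Fintype.card V : ℝ) * k * q * z ≤ g)
    (hb1 : ∀ T, IsKrTilingOn G (k + 1) T univ → ∀ c, (q : ℝ) * ((∑ K ∈ T, c2 (bt f {c}) K : ℤ) : ℝ) <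
      Fintype.card V * k * (1 + z))
    (hb2 : ∀ T, IsKrTilingOn G (k + 1) T univ → ∀ c, ((k : ℝ) + 1) * ((∑ K ∈ T, c2 (bt f {c}) K : ℤ) : ℝ) <
      2 * (Fintype.card V - 2 * h - ε * Fintype.card V)) : False := by
  obtain ⟨𝒮, g1, g2, g3, g4⟩ := gad_family G (r := k + 1) (by omega) f g
  have : Nonempty (Fin q) := ⟨⟨0, by omega⟩⟩
  choose! hgc γ τ1 τ2 t1 t2 t3 using g1
  set n := Fintype.card V with hn
  set W := univ \ 𝒮.biUnion id with hWd
  set U := 𝒮.biUnion id with hU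
  have hWU : W ∪ U = univ := by rw [hWd]; simp
  have hdis : Disjoint W U := by rw [hWd]; exact sdiff_disjoint
  have hcard : W.card + U.card = n := by
    rw [← card_union_of_disjoint hdis, hWU, card_univ]
  have hUc : U.card ≤ 3 * (k + 1) * g := by
    have := card_biUnion_le_card_mul 𝒮 id (3 * (k + 1)) hgc
    calc U.card ≤ 𝒮.card * (3 * (k + 1)) := this
      _ ≤ g * (3 * (k + 1)) := Nat.mul_le_mul_right _ g3
      _ = _ := mul_comm _ _
  have hkR : (2 : ℝ) ≤ k := by exact_mod_cast hk
  have hqR : (2 : ℝ) ≤ q := by exact_mod_cast hq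
  have hgR : (0 : ℝ) ≤ g := by positivity
  have hhR : (0 : ℝ) ≤ h := by positivity
  have hUR : (U.card : ℝ) ≤ 3 * (k + 1) * g := by exact_mod_cast hUc
  have hcR : (W.card : ℝ) + U.card = n := by exact_mod_cast hcard
  have hU0 : (0 : ℝ) ≤ U.card := by positivity
  have hnpos : (0 : ℝ) < n := by
    have : (0 : ℝ) ≤ 3 * ((k : ℝ) + 1) * g * (2 * q) := by positivity
    linarith
  have hεn : 0 < ε * n := mul_pos hε hnpos
  have hUε : (U.card : ℝ) + 5 * (k + 1) < ε * n := by linarith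
  have hεle : ε * n ≤ (k + 1) * (ε * n) := by nlinarith
  have hhW : ∀ v ∈ W, (W.filter (fun u => ¬ G.Adj v u)).card ≤ h := fun v _ =>
    (card_le_card (filter_subset_filter _ (subset_univ _))).trans (hh v)
  have hWh : (k + 1) * h + 5 * (k + 1) < W.card := by
    have : ((k : ℝ) + 1) * h + 5 * (k + 1) < W.card := by linarith
    exact_mod_cast this
  have hR := rob_of (r := k + 1) (C := 5 * (k + 1)) hhW hWh
  obtain ⟨TU, hTU, -⟩ := tiling_biUnion (by omega) τ1 𝒮 t1 g2
  obtain ⟨T0, hT0⟩ := HS_tiling G (k + 1) W (by omega) (by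
    have : (k + 1) ∣ U.card := by rw [tiling_card hTU]; exact dvd_mul_left _ _
    rw [← hcard] at hdiv
    exact (Nat.dvd_add_left this).1 hdiv) (by
    intro v hv
    have h5 := Nat.mul_le_mul_right (k + 1) (hhW v hv)
    have h6 : h * (k + 1) = (k + 1) * h := mul_comm _ _
    omega)
  -- total count
  have htot : ∀ T, IsKrTilingOn G (k + 1) T univ → ∀ B : Finset (Fin q),
      ((∑ K ∈ T, c2 (bt f B) K : ℤ) : ℝ) + ∑ c ∈ Bᶜ, ((∑ K ∈ T, c2 (bt f {c}) K : ℤ) : ℝ) = n * k := by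
    intro T hT B
    have e1 := tiling_c2_univ f hT
    rw [tiling_c2_split f univ, ← sum_add_sum_compl B, ← tiling_c2_split f B, card_univ] at e1
    exact_mod_cast e1
  -- lower bound
  have hlow : ∀ T, IsKrTilingOn G (k + 1) T univ → ∀ c,
      (n : ℝ) * k * (1 - (q - 1) * z) ≤ q * ((∑ K ∈ T, c2 (bt f {c}) K : ℤ) : ℝ) := by
    intro T hT c
    have e1 := htot T hT {c}
    have e2 : ∑ c ∈ ({c} : Finset (Fin q))ᶜ, ((∑ K ∈ T, c2 (bt f {c}) K : ℤ) : ℝ) * q ≤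
        (({c} : Finset (Fin q))ᶜ).card • (n * k * (1 + z)) := by
      apply sum_le_card_nsmul
      intro c' _
      have := hb1 T hT c'
      linarith
    rw [card_compl, card_singleton, Fintype.card_fin, nsmul_eq_mul, ← sum_mul, Nat.cast_sub (by omega)] at e2
    push_cast at e1 e2 ⊢
    nlinarith
  rcases g4 with g4 | g4
  · -- many gadgets
    have hpig : ∃ c : Fin q, g ≤ q * (𝒮.filter (fun S => γ S = c)).card := by
      by_contra hno
      push Not at hno
      have e1 : 𝒮.card = ∑ c : Fin q, (𝒮.filter (fun S => γ S = c)).card :=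
        card_eq_sum_card_fiberwise (fun S _ => mem_univ _)
      have hne : (univ : Finset (Fin q)).Nonempty := ⟨⟨0, by omega⟩, mem_univ _⟩
      have e2 : ∑ c : Fin q, q * (𝒮.filter (fun S => γ S = c)).card < ∑ _c : Fin q, g :=
        sum_lt_sum_of_nonempty hne (fun c _ => hno c)
      rw [← mul_sum, ← e1, sum_const, card_univ, Fintype.card_fin, smul_eq_mul, g4] at e2
      omega
    obtain ⟨c, hc⟩ := hpig
    obtain ⟨TH, hTH, sH⟩ := tiling_biUnion (G := G) (r := k + 1) (by omega)
      (fun S => if γ S = c then τ2 S else τ1 S) 𝒮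
      (by intro S hS; split_ifs; exacts [t2 S hS, t1 S hS]) g2
    obtain ⟨TL, hTL, sL⟩ := tiling_biUnion (G := G) (r := k + 1) (by omega) τ1 𝒮 t1 g2
    obtain ⟨a1, a2⟩ := tiling_union (by omega) hT0 hTH hdis
    obtain ⟨b1, b2⟩ := tiling_union (by omega) hT0 hTL hdis
    rw [hWU] at a1 b1
    have e1 := hb1 _ a1 c
    have e2 := hlow _ b1 c
    rw [a2, sH] at e1
    rw [b2, sL] at e2
    have e3 : ((𝒮.filter (fun S => γ S = c)).card : ℤ) + ∑ S ∈ 𝒮, ∑ K ∈ τ1 S, c2 (bt f {c}) K ≤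
        ∑ S ∈ 𝒮, ∑ K ∈ (if γ S = c then τ2 S else τ1 S), c2 (bt f {c}) K := by
      rw [card_filter]
      push_cast
      rw [← sum_add_distrib]
      apply sum_le_sum
      intro S hS
      by_cases hγ : γ S = c
      · have := t3 S hS
        rw [hγ] at this
        rw [if_pos hγ, if_pos hγ]
        linarith
      · rw [if_neg hγ, if_neg hγ]
        linarith
    have e4 : ((𝒮.filter (fun S => γ S = c)).card : ℝ) + ((∑ S ∈ 𝒮, ∑ K ∈ τ1 S, c2 (bt f {c}) K : ℤ) : ℝ) ≤
        ((∑ S ∈ 𝒮, ∑ K ∈ (if γ S = c then τ2 S else τ1 S), c2 (bt f {c}) K : ℤ) : ℝ) := by exact_mod_cast e3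
    have e5 : (g : ℝ) ≤ q * (𝒮.filter (fun S => γ S = c)).card := by exact_mod_cast hc
    have e6 := mul_le_mul_of_nonneg_left e4 (by linarith : (0 : ℝ) ≤ q)
    rw [Int.cast_add] at e1 e2
    nlinarith
  · -- gadget free
    obtain ⟨a1, a2⟩ := tiling_union (by omega) hT0 hTU hdis
    rw [hWU] at a1
    have hWh' : (k + 1) * h ≤ W.card := by omega
    -- upper bound for B
    have hup : ∀ B : Finset (Fin q), ((∑ K ∈ T0 ∪ TU, c2 (bt f B) K : ℤ) : ℝ) ≤
        ((∑ K ∈ T0, c2 (bt f B) K : ℤ) : ℝ) + U.card * k := by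
      intro B
      rw [a2]
      have := tiling_c2_le f hTU B
      have : ((∑ K ∈ TU, c2 (bt f B) K : ℤ) : ℝ) ≤ U.card * k := by exact_mod_cast this
      rw [Int.cast_add]
      linarith
    set X : ℝ := n - 2 * h - ε * n with hX
    have hX0 : 0 ≤ X := by
      have : 3 * ((h : ℝ) + ε * n) ≤ (k + 1) * (h + ε * n) := by nlinarith
      linarith
    have hcomp : ∀ S : Finset (Fin q), (k + 1) * ∑ c ∈ S, ((∑ K ∈ T0 ∪ TU, c2 (bt f {c}) K : ℤ) : ℝ) ≤
        S.card * (2 * X) := by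
      intro S
      have := sum_le_card_nsmul S (fun c => ((k : ℝ) + 1) * ((∑ K ∈ T0 ∪ TU, c2 (bt f {c}) K : ℤ) : ℝ)) (2 * X)
        (fun c _ => (hb2 _ a1 c).le)
      rw [← mul_sum, nsmul_eq_mul] at this
      exact this
    rcases struct_main g4 hR le_rfl hk hhW hWh' with ⟨B, hB, y, hL, hy⟩ | ⟨hreg, hrest⟩
    · have e1 := htot _ a1 B
      have e2 := hup B
      have e3 := hcomp Bᶜ
      rw [tiling_law hT0 hL] at e2
      have e4 : ((∑ x ∈ W, y x : ℤ) : ℝ) ≤ k * h := by exact_mod_cast hy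
      have e5 : 2 * (Bᶜ.card : ℝ) ≤ (k + 1) * k := by exact_mod_cast hB
      have e6 := mul_le_mul_of_nonneg_right e5 hX0
      rw [Int.cast_mul] at e2
      push_cast at e2 e1 e3 e4
      have e7 : ((k : ℝ) + 1) * (n * k) ≤ (k + 1) * (2 * (k * h) + U.card * k + k * X) := by
        rw [← e1, mul_add]
        have := mul_le_mul_of_nonneg_left (e2.trans (by linarith :
          2 * (∑ x ∈ W, (y x : ℝ)) + U.card * k ≤ 2 * (k * h) + U.card * k)) (by linarith : (0 : ℝ) ≤ k + 1)
        linarith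
      have e8 := le_of_mul_le_mul_left e7 (by linarith)
      have e9 : (k : ℝ) * n ≤ k * (2 * h + U.card + X) := by linarith
      have e10 := le_of_mul_le_mul_left e9 (by linarith)
      linarith
    · have hregR : (W.card : ℝ) ≤ (k + 2) * h := by exact_mod_cast hreg
      rcases hrest with hq' | ⟨c, hc⟩ | ⟨B, hB, y, hL, hy⟩
      · have e1 := htot _ a1 ∅
        have e3 := hcomp univ
        have e5 : 2 * (q : ℝ) ≤ (k + 2) * (k + 1) := by exact_mod_cast hq'
        have e6 := mul_le_mul_of_nonneg_right e5 hX0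
        rw [compl_empty] at e1
        have e0 : ∑ K ∈ T0 ∪ TU, c2 (bt f ∅) K = 0 := by rw [tiling_c2_split]; simp
        rw [e0, Int.cast_zero, zero_add] at e1
        rw [e1, card_univ, Fintype.card_fin] at e3
        have e7 : ((k : ℝ) + 1) * (n * k) ≤ (k + 1) * ((k + 2) * X) := by nlinarith
        have e8 := le_of_mul_le_mul_left e7 (by linarith)
        rw [hX] at e8
        nlinarith
      · have e1 := hlow _ a1 c
        have e2 := hup {c}
        have e3 : ∑ K ∈ T0, c2 (bt f {c}) K = 0 := by
          apply sum_eq_zero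
          intro K hK
          have hKT := TC_of_nclique (hT0.2.2 ▸ subset_biUnion_of_mem id hK : K ⊆ W) (hT0.1 K hK)
          apply c2_zero
          intro u hu x hx
          apply bt_zero
          intro hux hm
          exact hc u (hKT.1 hu) x (hKT.1 hx) (hKT.2.2 u hu x hx hux) (mem_singleton.1 hm)
        rw [e3, Int.cast_zero, zero_add] at e2
        have e4 := mul_le_mul_of_nonneg_left e2 (by linarith : (0 : ℝ) ≤ q)
        have e5 : (1 : ℝ) / 2 ≤ 1 - (q - 1) * z := by linarith
        have e6 : (n : ℝ) * k * (1 / 2) ≤ n * k * (1 - (q - 1) * z) :=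
          mul_le_mul_of_nonneg_left e5 (by positivity)
        have e7 : (k : ℝ) * n ≤ k * (U.card * (2 * q)) := by linarith
        have e8 := le_of_mul_le_mul_left e7 (by linarith)
        have e9 : (U.card : ℝ) * (2 * q) ≤ 3 * (k + 1) * g * (2 * q) :=
          mul_le_mul_of_nonneg_right hUR (by linarith)
        linarith
      · have e1 := htot _ a1 B
        have e2 := hup B
        have e3 := hcomp Bᶜ
        rw [tiling_law hT0 hL] at e2
        have e4 : ((∑ x ∈ W, y x : ℤ) : ℝ) ≤ (k - 1) * h := by exact_mod_cast hy
        have e5 : 2 * (Bᶜ.card : ℝ) ≤ (k + 1) * k + 2 := by exact_mod_cast hB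
        have e6 := mul_le_mul_of_nonneg_right e5 hX0
        rw [Int.cast_mul] at e2
        push_cast at e2 e1 e3 e4
        have e7 : ((k : ℝ) + 1) * (n * k) ≤ (k + 1) * (2 * ((k - 1) * h) + U.card * k) + ((k + 1) * k + 2) * X := by
          rw [← e1, mul_add]
          have := mul_le_mul_of_nonneg_left (e2.trans (by linarith :
            2 * (∑ x ∈ W, (y x : ℝ)) + U.card * k ≤ 2 * ((k - 1) * h) + U.card * k)) (by linarith : (0 : ℝ) ≤ k + 1)
          linarith
        rw [hX] at e7
        have e8 : ((k : ℝ) + 1) * k * U.card ≤ (k + 1) * k * (ε * n) :=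
          mul_le_mul_of_nonneg_left (by linarith) (by positivity)
        nlinarith
end ST10

section ST11
open Classical
variable [DecidableEq V]

lemma count_bridge {q : ℕ} (f : Sym2 V → Fin q) (T : Finset (Finset V)) (c : Fin q) :
    ∑ K ∈ T, c2 (bt f {c}) K = 2 * (tilingColorCount f T c : ℤ) := by
  unfold tilingColorCount
  push_cast
  rw [mul_sum]
  refine sum_congr rfl (fun K _ => ?_)
  rw [c2_bridge]
  simp only [mem_singleton]

lemma edge_bridge {G : SimpleGraph V} {k q : ℕ} (f : Sym2 V → Fin q) {T : Finset (Finset V)} {W : Finset V}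
    (h : IsKrTilingOn G (k + 1) T W) : 2 * (tilingEdgeCount T : ℤ) = W.card * k := by
  rw [← tiling_c2_univ f h]
  unfold tilingEdgeCount
  push_cast
  rw [mul_sum]
  refine sum_congr rfl (fun K _ => ?_)
  rw [c2_bridge]
  simp only [mem_univ, and_true]

lemma nonnbr_card {n : ℕ} (G : SimpleGraph (Fin n)) [DecidableRel G.Adj] (v : Fin n) :
    (univ.filter (fun u => ¬ G.Adj v u)).card ≤ n - G.minDegree := by
  have h1 := card_filter_add_card_filter_not (s := (univ : Finset (Fin n))) (fun u => G.Adj v u)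
  have h2 : (univ.filter (fun u => G.Adj v u)).card = G.degree v := by
    rw [← SimpleGraph.card_neighborFinset_eq_degree, SimpleGraph.neighborFinset_eq_filter]
  have h3 := G.minDegree_le_degree v
  rw [card_univ, Fintype.card_fin] at h1
  omega
end ST11

/-- **Lemma.** For `r ≥ 3`, `q ≥ 2`, `ε > 0`, there exist `ζ > 0` and `n₀` such that any
`q`-edge-colored `n`-vertex graph (`n ≥ n₀`, `r ∣ n`) with `δ(G) ≥ ((r−1)/r + ε)n` has a
`K_r`-tiling in which some color appears on at least a
`min(1/q + ζ, (ρ − ε)/C(r,2))`-fraction of the edges, where `ρ = 2δ(G)/n − 1`. -/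
theorem tiling_with_popular_color (r q : ℕ) (hr : 3 ≤ r) (hq : 2 ≤ q)
    (ε : ℝ) (hε : 0 < ε) :
    ∃ ζ : ℝ, 0 < ζ ∧ ∃ n₀ : ℕ, ∀ n : ℕ, n₀ ≤ n → r ∣ n →
      ∀ (G : SimpleGraph (Fin n)) [DecidableRel G.Adj],
        (((r : ℝ) - 1) / r + ε) * n ≤ G.minDegree →
        ∀ f : Sym2 (Fin n) → Fin q,
          ∃ T : Finset (Finset (Fin n)), IsKrTiling G r T ∧
            ∃ c : Fin q,
              min ((1 : ℝ) / q + ζ)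
                  ((2 * (G.minDegree : ℝ) / n - 1 - ε) / ((r : ℝ) * ((r : ℝ) - 1) / 2)) *
                (tilingEdgeCount T : ℝ) ≤ (tilingColorCount f T c : ℝ) := by
  obtain ⟨k, rfl⟩ : ∃ k, r = k + 1 := ⟨r - 1, by omega⟩
  have hk : 2 ≤ k := by omega
  have hkR : (2 : ℝ) ≤ k := by exact_mod_cast hk
  have hqR : (2 : ℝ) ≤ q := by exact_mod_cast hq
  have hq0 : (0 : ℝ) < q := by linarith
  have hr0 : (0 : ℝ) < (k : ℝ) + 1 := by linarith
  obtain ⟨η, hη0, hη1, hη2⟩ : ∃ η : ℝ, 0 < η ∧ 24 * ((k : ℝ) + 1) * η ≤ ε ∧ 24 * ((k : ℝ) + 1) * η * q ≤ 1 := by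
    refine ⟨min ε (1 / q) / (24 * ((k : ℝ) + 1)), by positivity, ?_, ?_⟩
    · rw [mul_div_cancel₀ _ (by positivity)]
      exact min_le_left _ _
    · rw [mul_div_cancel₀ _ (by positivity)]
      calc min ε (1 / (q : ℝ)) * q ≤ 1 / q * q := mul_le_mul_of_nonneg_right (min_le_right _ _) hq0.le
        _ = 1 := by field_simp
  obtain ⟨z, hz⟩ : ∃ z : ℝ, z = η / (q * (k + 1)) := ⟨_, rfl⟩
  have hz0 : 0 < z := by rw [hz]; positivity
  have hz' : q * (k + 1) * z = η := by rw [hz]; field_simp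
  obtain ⟨N, hN⟩ := exists_nat_ge (1 / η + 20 * ((k : ℝ) + 1) / ε)
  refine ⟨z / q, by positivity, N + 1, ?_⟩
  intro n hn hdiv G _ hdeg f
  by_contra hcon
  push Not at hcon
  have hnN : (N : ℝ) + 1 ≤ n := by exact_mod_cast hn
  have hn0 : (0 : ℝ) < n := by linarith [(Nat.cast_nonneg N : (0 : ℝ) ≤ N)]
  have p1 : 0 < 1 / η := by positivity
  have p2 : 0 < 20 * ((k : ℝ) + 1) / ε := by positivity
  have hn1 : 1 ≤ η * n := by
    have : 1 / η ≤ n := by linarith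
    rw [div_le_iff₀ hη0] at this
    linarith
  have hn2 : 20 * ((k : ℝ) + 1) ≤ ε * n := by
    have : 20 * ((k : ℝ) + 1) / ε ≤ n := by linarith
    rw [div_le_iff₀ hε] at this
    linarith
  have hgl : η * n ≤ ⌈η * n⌉₊ := Nat.le_ceil _
  have hgu : (⌈η * n⌉₊ : ℝ) < η * n + 1 := Nat.ceil_lt_add_one (by positivity)
  have hg2 : (⌈η * n⌉₊ : ℝ) ≤ 2 * (η * n) := by linarith
  have hδ : G.minDegree ≤ n := by
    have hnpos : 0 < n := by exact_mod_cast hn0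
    have h1 := G.minDegree_le_degree ⟨0, hnpos⟩
    have h2 := G.degree_lt_card_verts ⟨0, hnpos⟩
    rw [Fintype.card_fin] at h2
    omega
  have hhR : ((n - G.minDegree : ℕ) : ℝ) = n - G.minDegree := by rw [Nat.cast_sub hδ]
  push_cast at hdeg hcon
  have hdeg' : ((k : ℝ) + (k + 1) * ε) * n ≤ (k + 1) * G.minDegree := by
    have h1 := mul_le_mul_of_nonneg_left hdeg hr0.le
    calc ((k : ℝ) + (k + 1) * ε) * n = (k + 1) * (((k + 1 - 1) / (k + 1) + ε) * n) := by
          field_simp; ring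
      _ ≤ _ := h1
  have hbr : ∀ T, IsKrTilingOn G (k + 1) T univ → ∀ c,
      ((∑ K ∈ T, c2 (bt f {c}) K : ℤ) : ℝ) = 2 * (tilingColorCount f T c : ℝ) ∧
      2 * (tilingEdgeCount T : ℝ) = n * k := by
    intro T hT c
    have h1 := count_bridge f T c
    have h2 := edge_bridge f hT
    rw [card_univ, Fintype.card_fin] at h2
    exact ⟨by exact_mod_cast h1, by exact_mod_cast h2⟩
  have hE0 : ∀ T : Finset (Finset (Fin n)), (0 : ℝ) ≤ tilingEdgeCount T := fun T => Nat.cast_nonneg _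
  refine core (V := Fin n) (G := G) (k := k) (h := n - G.minDegree) (g := ⌈η * n⌉₊) (ε := ε) (z := z) hk hq hε f
    (by rw [Fintype.card_fin]; exact hdiv) ?_ ?_ ?_ ?_ hz0 ?_ ?_ ?_ ?_
  · intro v
    have := nonnbr_card G v
    convert this
  · rw [Fintype.card_fin, hhR]
    linarith
  · rw [Fintype.card_fin]
    have h1 := mul_le_mul_of_nonneg_right hη1 hn0.le
    have h2 := mul_le_mul_of_nonneg_left hg2 (by positivity : (0 : ℝ) ≤ 3 * (k + 1))
    nlinarith
  · rw [Fintype.card_fin]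
    have h1 := mul_le_mul_of_nonneg_right hη2 hn0.le
    have h2 := mul_le_mul_of_nonneg_left hg2 (by positivity : (0 : ℝ) ≤ 3 * (k + 1) * (2 * q))
    nlinarith
  · have h1 : 0 < q * z := by positivity
    have h2 : 0 < ((k : ℝ) + 1) * η := by positivity
    nlinarith
  · rw [Fintype.card_fin]
    have h1 : (n : ℝ) * k * q * z ≤ n * (q * (k + 1) * z) := by
      have : 0 ≤ (n : ℝ) * q * z := by positivity
      nlinarith
    rw [hz'] at h1
    linarith
  · intro T hT c
    rw [Fintype.card_fin]
    obtain ⟨b1, b2⟩ := hbr T hT c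
    have h1 := (hcon T hT c).trans_le (mul_le_mul_of_nonneg_right (min_le_left _ _) (hE0 T))
    rw [b1, ← b2]
    have h2 := mul_lt_mul_of_pos_left h1 (by linarith : (0 : ℝ) < 2 * q)
    calc (q : ℝ) * (2 * (tilingColorCount f T c : ℝ)) = 2 * q * tilingColorCount f T c := by ring
      _ < _ := h2
      _ = _ := by field_simp
  · intro T hT c
    rw [Fintype.card_fin, hhR]
    obtain ⟨b1, b2⟩ := hbr T hT c
    have h1 := (hcon T hT c).trans_le (mul_le_mul_of_nonneg_right (min_le_right _ _) (hE0 T))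
    rw [b1]
    have h2 := mul_lt_mul_of_pos_left h1 (by linarith : (0 : ℝ) < 2 * (k + 1))
    have h3 : (tilingEdgeCount T : ℝ) = n * k / 2 := by linarith
    have hk0 : (k : ℝ) ≠ 0 := by linarith
    calc ((k : ℝ) + 1) * (2 * (tilingColorCount f T c : ℝ)) = 2 * (k + 1) * tilingColorCount f T c := by ring
      _ < _ := h2
      _ = _ := by
        rw [h3, add_sub_cancel_right]
        field_simp
        ring
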